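/- arXiv:1809.06271 — 3 statements merged into one kernel-verified Lean document; each statement's English description precedes it below -/
import Mathlib

section
/- Let q be a power of 2 and let f = Σ_{i=0}^d A_i X^i ∈ F_q[X] with A_d ≠ 0, d ≥ 3, d^4 ≤ q, and such that A_i = 0 whenever i is a power of two. If the associated polynomial F ∈ F_q[X,Y] has an absolutely irreducible factor over F_q, then f is not planar on F_q. -/
open MvPolynomial

/-- `P ∈ F_q[X,Y]` has a factor of positive degree that is absolutely irreducible,
i.e. irreducible over an algebraic closure of `F_q`. -/
def HasAbsIrrFactor {K : Type*} [Field K] (P : MvPolynomial (Fin 2) K) : Prop :=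
  ∃ Q : MvPolynomial (Fin 2) K, Q ∣ P ∧ 0 < Q.totalDegree ∧
    Irreducible (MvPolynomial.map (algebraMap K (AlgebraicClosure K)) Q)

namespace Polynomial.PlaneCurve

open scoped Polynomial

section

variable {K S : Type*} [Field K] [CommRing S] [Algebra K S]

/-- Bivariate polynomials of total degree at most `m` with all coefficients in `T`. -/
def boxed (T : Submodule K S) (m : ℕ) : Submodule K S[X][X] where
  carrier := {p | ∀ i j, (p.coeff j).coeff i ∈ T ∧ (m < i + j → (p.coeff j).coeff i = 0)}
  add_mem' := fun {p q} hp hq i j => by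
    refine ⟨?_, fun h => ?_⟩
    · simpa using T.add_mem (hp i j).1 (hq i j).1
    · simp [(hp i j).2 h, (hq i j).2 h]
  zero_mem' := fun i j => by simp
  smul_mem' := fun c p hp i j => by
    refine ⟨?_, fun h => ?_⟩
    · simpa using T.smul_mem c (hp i j).1
    · simp [(hp i j).2 h]

lemma mem_boxed {T : Submodule K S} {m : ℕ} {p : S[X][X]} :
    p ∈ boxed T m ↔ ∀ i j, (p.coeff j).coeff i ∈ T ∧ (m < i + j → (p.coeff j).coeff i = 0) :=
  Iff.rfl

lemma boxed_mono {T T' : Submodule K S} (h : T ≤ T') {m m' : ℕ} (hm : m ≤ m') :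
    boxed T m ≤ boxed T' m' := fun _ hp i j =>
  ⟨h (hp i j).1, fun h' => (hp i j).2 (by omega)⟩

lemma mul_mem_boxed {T T' : Submodule K S} {m m' : ℕ} {p p' : S[X][X]}
    (hp : p ∈ boxed T m) (hp' : p' ∈ boxed T' m') : p * p' ∈ boxed (T * T') (m + m') := by
  intro i j
  have key : ((p * p').coeff j).coeff i =
      ∑ x ∈ Finset.HasAntidiagonal.antidiagonal j, ∑ y ∈ Finset.HasAntidiagonal.antidiagonal i,
        (p.coeff x.1).coeff y.1 * (p'.coeff x.2).coeff y.2 := by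
    rw [coeff_mul, finsetSum_coeff]
    exact Finset.sum_congr rfl fun x _ => coeff_mul _ _ _
  rw [key]
  refine ⟨Submodule.sum_mem _ fun x _ => Submodule.sum_mem _ fun y _ =>
    Submodule.mul_mem_mul (hp _ _).1 (hp' _ _).1, fun h => ?_⟩
  refine Finset.sum_eq_zero fun x hx => Finset.sum_eq_zero fun y hy => ?_
  rw [Finset.HasAntidiagonal.mem_antidiagonal] at hx hy
  by_cases h1 : m < y.1 + x.1
  · rw [(hp _ _).2 h1, zero_mul]
  · rw [(hp' y.2 x.2).2 (by omega), mul_zero]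

lemma monomial_mem_boxed {T : Submodule K S} {m i j : ℕ} {t : S} (ht : t ∈ T) (h : i + j ≤ m) :
    monomial j (monomial i t) ∈ boxed T m := by
  intro i' j'
  rw [coeff_monomial]
  split_ifs with hj
  · rw [coeff_monomial]
    split_ifs with hi
    · exact ⟨ht, by omega⟩
    · simp
  · simp

lemma boxed_induction {T : Submodule K S} {m : ℕ} {P : S[X][X] → Prop} {p : S[X][X]}
    (hp : p ∈ boxed T m) (h0 : P 0) (hadd : ∀ a b, P a → P b → P (a + b))
    (hmon : ∀ i j t, t ∈ T → i + j ≤ m → j ≤ p.natDegree → P (monomial j (monomial i t))) :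
    P p := by
  have hsum : ∀ {ι : Type} (s : Finset ι) (g : ι → S[X][X]), (∀ i ∈ s, P (g i)) →
      P (∑ i ∈ s, g i) := by
    intro ι s g hg
    exact Finset.sum_induction g P hadd h0 hg
  rw [p.as_sum_range]
  refine hsum _ _ fun j hj => ?_
  rw [(p.coeff j).as_sum_range, map_sum]
  refine hsum _ _ fun i hi => ?_
  rw [Finset.mem_range] at hj
  by_cases h : i + j ≤ m
  · exact hmon i j _ (hp i j).1 h (by omega)
  · rw [(hp i j).2 (by omega)]
    simpa using h0

lemma map_mem_boxed {G : K[X][X]} {m : ℕ} (hG : G ∈ boxed (⊤ : Submodule K K) m) :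
    G.map (mapRingHom (algebraMap K S)) ∈ boxed (1 : Submodule K S) m := by
  intro i j
  simp only [coeff_map, coe_mapRingHom]
  refine ⟨Submodule.mem_one.2 ⟨_, rfl⟩, fun h => ?_⟩
  rw [(hG i j).2 h, map_zero]

lemma modByMonic_mem_boxed {g : S[X][X]} (hg : g.Monic)
    (hgb : g ∈ boxed (1 : Submodule K S) g.natDegree) {T : Submodule K S} {m : ℕ} {p : S[X][X]}
    (hp : p ∈ boxed T m) : p %ₘ g ∈ boxed T m := by
  induction hn : p.natDegree using Nat.strong_induction_on generalizing p with
  | _ n ih =>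
  by_cases hlt : p.degree < g.degree
  · nontriviality S
    rwa [(modByMonic_eq_self_iff hg).2 hlt]
  nontriviality S
  by_cases hp0 : p = 0
  · subst hp0; simp
  rw [not_lt] at hlt
  by_cases hg1 : g = 1
  · subst hg1; simp
  have hg0 : 0 < g.natDegree := by
    rcases Nat.eq_zero_or_pos g.natDegree with h | h
    · exact absurd (hg.natDegree_eq_zero.1 h) hg1
    · exact h
  have hle : g.natDegree ≤ p.natDegree := natDegree_le_natDegree hlt
  set r := C p.leadingCoeff * X ^ (p.natDegree - g.natDegree) with hr
  have hrm : ∀ _ : g.natDegree ≤ m, r ∈ boxed T (m - g.natDegree) := by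
    intro hgm i j
    rw [hr, coeff_C_mul, coeff_X_pow]
    split_ifs with hj
    · rw [mul_one]
      refine ⟨(hp _ _).1, fun h => (hp _ _).2 (by omega)⟩
    · simp
  have hgm : g.natDegree ≤ m := by
    by_contra hcon
    apply hp0
    rw [← leadingCoeff_eq_zero]
    ext i
    exact (hp _ _).2 (by omega)
  have hsub : p - g * r ∈ boxed T m := by
    refine Submodule.sub_mem _ hp ?_
    have := mul_mem_boxed hgb (hrm hgm)
    rwa [one_mul, Nat.add_sub_cancel' hgm] at this
  have hdeg : (p - g * r).degree < p.degree := by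
    have := div_wf_lemma ⟨hlt, hp0⟩ hg
    exact this
  have hmod : (p - g * r) %ₘ g = p %ₘ g := by
    rw [sub_modByMonic, (modByMonic_eq_zero_iff_dvd hg).2 (dvd_mul_right _ _), sub_zero]
  rw [← hmod]
  by_cases h0 : p - g * r = 0
  · rw [h0]; simp
  · exact ih _ (by rw [← hn]; exact natDegree_lt_natDegree h0 hdeg) hsub rfl

end

section

variable {K S : Type*} [Field K] [CommRing S] [Algebra K S]

variable (S) in
/-- Extension of scalars of a bivariate polynomial. -/
noncomputable abbrev ext (G : K[X][X]) : S[X][X] := G.map (mapRingHom (algebraMap K S))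

variable (S) in
/-- The coordinate ring of the affine plane curve `G = 0` over `S`. -/
abbrev CoordRing (G : K[X][X]) : Type _ := AdjoinRoot (ext S G)

/-- `G` is monic in the second variable, of total degree equal to its degree. -/
structure Good (G : K[X][X]) : Prop where
  monic : G.Monic
  mem_boxed : G ∈ boxed (⊤ : Submodule K K) G.natDegree

variable {G : K[X][X]}

lemma Good.ext_monic (hG : Good G) : (ext S G).Monic := hG.monic.map _

lemma Good.natDegree_ext [Nontrivial S] (hG : Good G) : (ext S G).natDegree = G.natDegree :=
  hG.monic.natDegree_map _

/-- The normal form of an element of the coordinate ring. -/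
noncomputable def rep (hG : Good G) : CoordRing S G →ₗ[S[X]] S[X][X] :=
  AdjoinRoot.modByMonicHom hG.ext_monic

lemma mk_rep (hG : Good G) (N : CoordRing S G) : AdjoinRoot.mk (ext S G) (rep hG N) = N :=
  AdjoinRoot.mk_leftInverse _ N

lemma rep_mk (hG : Good G) (p : S[X][X]) :
    rep hG (AdjoinRoot.mk (ext S G) p) = p %ₘ ext S G :=
  AdjoinRoot.modByMonicHom_mk _ p

lemma rep_injective (hG : Good G) : Function.Injective (rep (S := S) hG) :=
  Function.LeftInverse.injective (g := AdjoinRoot.mk (ext S G)) (mk_rep hG)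

lemma rep_coeff_eq_zero [Nontrivial S] (hG : Good G) (N : CoordRing S G) {j : ℕ}
    (hj : G.natDegree ≤ j) :
    (rep hG N).coeff j = 0 := by
  obtain ⟨p, rfl⟩ := AdjoinRoot.mk_surjective N
  rw [rep_mk]
  apply coeff_eq_zero_of_degree_lt
  refine (degree_modByMonic_lt p hG.ext_monic).trans_le ?_
  rw [degree_eq_natDegree hG.ext_monic.ne_zero, hG.natDegree_ext]
  exact_mod_cast hj

/-- Elements of the coordinate ring represented by polynomials of total degree at most `m` with
coefficients in `T`. -/
noncomputable def fil (G : K[X][X]) (T : Submodule K S) (m : ℕ) : Submodule K (CoordRing S G) :=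
  (boxed T m).map ((AdjoinRoot.mkₐ (ext S G)).restrictScalars K).toLinearMap

lemma mk_mem_fil {T : Submodule K S} {m : ℕ} {p : S[X][X]} (hp : p ∈ boxed T m) :
    AdjoinRoot.mk (ext S G) p ∈ fil G T m := ⟨p, hp, rfl⟩

lemma mem_fil_iff [Nontrivial S] (hG : Good G) {T : Submodule K S} {m : ℕ} {N : CoordRing S G} :
    N ∈ fil G T m ↔ rep hG N ∈ boxed T m := by
  constructor
  · rintro ⟨p, hp, rfl⟩
    change rep hG (AdjoinRoot.mk (ext S G) p) ∈ _
    rw [rep_mk]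
    refine modByMonic_mem_boxed hG.ext_monic ?_ hp
    rw [hG.natDegree_ext]
    exact map_mem_boxed hG.mem_boxed
  · intro h
    rw [← mk_rep hG N]
    exact mk_mem_fil h

lemma fil_mono {T T' : Submodule K S} (h : T ≤ T') {m m' : ℕ} (hm : m ≤ m') :
    fil G T m ≤ fil G T' m' := Submodule.map_mono (boxed_mono h hm)

lemma mul_mem_fil {T T' T'' : Submodule K S} {m m' m'' : ℕ} {N N' : CoordRing S G}
    (hT : T * T' ≤ T'') (hm : m + m' ≤ m'') (hN : N ∈ fil G T m) (hN' : N' ∈ fil G T' m') :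
    N * N' ∈ fil G T'' m'' := by
  obtain ⟨p, hp, rfl⟩ := hN
  obtain ⟨p', hp', rfl⟩ := hN'
  refine fil_mono hT hm ⟨p * p', mul_mem_boxed hp hp', ?_⟩
  simp

variable (S G) in
/-- The first coordinate function. -/
noncomputable def xc : CoordRing S G := AdjoinRoot.mk (ext S G) (C X)

variable (S G) in
/-- The second coordinate function. -/
noncomputable def yc : CoordRing S G := AdjoinRoot.mk (ext S G) X

variable (G) in
/-- The inclusion of scalars. -/
noncomputable def sc : S →+* CoordRing S G := (AdjoinRoot.mk (ext S G)).comp (C.comp C)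

lemma mk_monomial (i j : ℕ) (t : S) : AdjoinRoot.mk (ext S G) (monomial j (monomial i t)) =
    sc G t * xc S G ^ i * yc S G ^ j := by
  simp [sc, xc, yc, ← C_mul_X_pow_eq_monomial]

lemma monomial_mem_fil {T : Submodule K S} {m i j : ℕ} {t : S} (ht : t ∈ T) (h : i + j ≤ m) :
    sc G t * xc S G ^ i * yc S G ^ j ∈ fil G T m := by
  rw [← mk_monomial]
  exact mk_mem_fil (monomial_mem_boxed ht h)

lemma fil_induction [Nontrivial S] (hG : Good G) {T : Submodule K S} {m : ℕ}
    {P : CoordRing S G → Prop}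
    {N : CoordRing S G} (hN : N ∈ fil G T m) (h0 : P 0) (hadd : ∀ a b, P a → P b → P (a + b))
    (hmon : ∀ i j t, t ∈ T → i + j ≤ m → j < G.natDegree →
      P (sc G t * xc S G ^ i * yc S G ^ j)) : P N := by
  by_cases hN0 : N = 0
  · rwa [hN0]
  have h1 := (mem_fil_iff hG).1 hN
  have h2 := mk_rep hG N
  rw [← h2]
  refine boxed_induction (P := fun p => P (AdjoinRoot.mk (ext S G) p)) h1 (by simpa using h0)
    (fun a b ha hb => by rw [map_add]; exact hadd _ _ ha hb) fun i j t ht hij hj => ?_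
  rw [mk_monomial]
  refine hmon i j t ht hij (hj.trans_lt ?_)
  by_contra hcon
  have h3 := rep_coeff_eq_zero hG N (not_lt.1 hcon)
  rw [coeff_natDegree, leadingCoeff_eq_zero] at h3
  rw [h3, map_zero] at h2
  exact hN0 h2.symm

lemma exists_mem_fil (N : CoordRing S G) : ∃ m, N ∈ fil G (⊤ : Submodule K S) m := by
  obtain ⟨p, rfl⟩ := AdjoinRoot.mk_surjective N
  refine ⟨p.natDegree + ∑ j ∈ Finset.range (p.natDegree + 1), (p.coeff j).natDegree,
    mk_mem_fil fun i j => ⟨trivial, fun h => ?_⟩⟩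
  by_cases hj : j ≤ p.natDegree
  · apply coeff_eq_zero_of_natDegree_lt
    have := Finset.single_le_sum (f := fun j => (p.coeff j).natDegree) (fun _ _ => Nat.zero_le _)
      (Finset.mem_range.2 (Nat.lt_succ_of_le hj))
    simp only [Nat.succ_eq_add_one] at this
    omega
  · rw [coeff_eq_zero_of_natDegree_lt (p := p) (by omega), coeff_zero]

lemma rep_mk_C_mul (hG : Good G) (c : S[X]) (N : CoordRing S G) :
    rep hG (AdjoinRoot.mk (ext S G) (C c) * N) = C c * rep hG N := by
  have : AdjoinRoot.mk (ext S G) (C c) * N = c • N := by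
    rw [Algebra.smul_def]; rfl
  rw [this, map_smul, smul_eq_C_mul]

lemma rep_sc_mul (hG : Good G) (c : S) (N : CoordRing S G) (i j : ℕ) :
    ((rep hG (sc G c * N)).coeff j).coeff i = c * ((rep hG N).coeff j).coeff i := by
  have := rep_mk_C_mul hG (C c) N
  change rep hG (sc G c * N) = _ at this
  rw [this, coeff_C_mul, coeff_C_mul]

lemma mem_fil_of_sub_mul_mem [Nontrivial S] (hG : Good G) {c : S} {N : CoordRing S G} {m : ℕ}
    (h : (xc S G - sc G c) * N ∈ fil G (⊤ : Submodule K S) (m + 1)) :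
    N ∈ fil G (⊤ : Submodule K S) m := by
  rw [mem_fil_iff hG] at h ⊢
  have h1 : xc S G - sc G c = AdjoinRoot.mk (ext S G) (C (X - C c)) := by
    simp [xc, sc]
  rw [h1, rep_mk_C_mul] at h
  refine fun i j => ⟨trivial, fun hij => ?_⟩
  by_cases h0 : (rep hG N).coeff j = 0
  · rw [h0, coeff_zero]
  have h2 := (h ((rep hG N).coeff j).natDegree.succ j).2
  rw [coeff_C_mul] at h2
  by_contra hne
  have h3 : i ≤ ((rep hG N).coeff j).natDegree := le_natDegree_of_ne_zero hne
  have h4 := h2 (by omega)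
  have h5 : ((X - C c) * (rep hG N).coeff j).natDegree =
      ((rep hG N).coeff j).natDegree.succ := by
    rw [(monic_X_sub_C c).natDegree_mul' h0, natDegree_X_sub_C]; omega
  rw [← h5, coeff_natDegree, leadingCoeff_monic_mul (monic_X_sub_C c), leadingCoeff_eq_zero] at h4
  exact h0 h4

lemma sub_mul_eq_zero (hG : Good G) {c : S} {N : CoordRing S G}
    (h : (xc S G - sc G c) * N = 0) : N = 0 := by
  have h1 : xc S G - sc G c = AdjoinRoot.mk (ext S G) (C (X - C c)) := by
    simp [xc, sc]
  apply rep_injective hG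
  have h2 := rep_mk_C_mul hG (X - C c) N
  rw [← h1, h, map_zero] at h2
  rw [map_zero]
  ext1 j
  have h3 := congrArg (fun p => coeff p j) h2
  simp only [coeff_zero, coeff_C_mul] at h3
  rw [coeff_zero]
  exact ((monic_X_sub_C c).mul_right_eq_zero_iff).1 h3.symm

/-- The exponents of the monomials of total degree at most `m` in normal form. -/
def exps (D m : ℕ) : Finset (Σ _ : ℕ, ℕ) := (Finset.range D).sigma fun j => Finset.range (m + 1 - j)

lemma mem_exps {D m : ℕ} {p : Σ _ : ℕ, ℕ} : p ∈ exps D m ↔ p.1 < D ∧ p.2 + p.1 ≤ m := by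
  rw [exps, Finset.mem_sigma, Finset.mem_range, Finset.mem_range]
  omega

lemma two_mul_card_exps {D m : ℕ} (h : D ≤ m + 1) :
    2 * (exps D m).card + D * D = 2 * (D * (m + 1)) + D := by
  rw [exps, Finset.card_sigma]
  simp only [Finset.card_range]
  induction D with
  | zero => simp
  | succ D ih =>
    have := ih (by omega)
    rw [Finset.sum_range_succ]
    obtain ⟨e, he⟩ := Nat.exists_eq_add_of_le h
    have : m + 1 - D = e + 1 := by omega
    rw [this]
    nlinarith

/-- The coefficients of the normal form, as a family indexed by exponents. -/
noncomputable def coeffs (hG : Good G) (m : ℕ) :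
    CoordRing S G →ₗ[S] (exps G.natDegree m → S) where
  toFun N e := ((rep hG N).coeff e.1.1).coeff e.1.2
  map_add' N N' := by ext; simp
  map_smul' c N := by
    ext e
    have : c • N = sc G c * N := by
      rw [Algebra.smul_def]; rfl
    rw [this, rep_sc_mul]; rfl

lemma coeffs_injOn [Nontrivial S] (hG : Good G) {m : ℕ} {N : CoordRing S G}
    (hN : N ∈ fil G (⊤ : Submodule K S) m) (h : coeffs hG m N = 0) : N = 0 := by
  apply rep_injective hG
  rw [map_zero]
  ext j i
  rw [coeff_zero, coeff_zero]
  by_cases hm : i + j ≤ m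
  · by_cases hj : j < G.natDegree
    · exact congrFun h ⟨⟨j, i⟩, mem_exps.2 ⟨hj, hm⟩⟩
    · rw [rep_coeff_eq_zero hG N (not_lt.1 hj), coeff_zero]
  · exact ((mem_fil_iff hG).1 hN i j).2 (by omega)

/-- The piece `fil G T m` is a product of copies of `T`. -/
noncomputable def filEquiv [Nontrivial S] (hG : Good G) (T : Submodule K S) (m : ℕ) :
    fil G T m ≃ₗ[K] (exps G.natDegree m → T) := by
  refine LinearEquiv.ofBijective
    { toFun := fun N e => ⟨coeffs hG m N.1 e, ((mem_fil_iff hG).1 N.2 _ _).1⟩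
      map_add' := fun N N' => by ext; simp
      map_smul' := fun c N => by
        ext e
        change coeffs hG m (c • N.1) e = c • coeffs hG m N.1 e
        rw [← algebraMap_smul S c N.1, map_smul, Pi.smul_apply, algebraMap_smul] } ⟨?_, ?_⟩
  · rw [injective_iff_map_eq_zero]
    intro N hN
    ext1
    refine coeffs_injOn hG (fil_mono le_top le_rfl N.2) ?_
    ext e
    exact congrArg Subtype.val (congrFun hN e)
  · intro c
    set p : S[X][X] := ∑ e : exps G.natDegree m, monomial e.1.1 (monomial e.1.2 (c e).1) with hp
    have hpb : p ∈ boxed T m := Submodule.sum_mem _ fun e _ =>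
      monomial_mem_boxed (c e).2 (mem_exps.1 e.2).2
    have hrep : rep hG (AdjoinRoot.mk (ext S G) p) = p := by
      rw [rep_mk, modByMonic_eq_self_iff hG.ext_monic]
      refine (degree_sum_le _ _).trans_lt ?_
      rw [Finset.sup_lt_iff (by
        rw [bot_lt_iff_ne_bot, Ne, degree_eq_bot]; exact hG.ext_monic.ne_zero)]
      intro e _
      refine (degree_monomial_le _ _).trans_lt ?_
      rw [degree_eq_natDegree hG.ext_monic.ne_zero, hG.natDegree_ext]
      exact_mod_cast (mem_exps.1 e.2).1
    refine ⟨⟨AdjoinRoot.mk (ext S G) p, mk_mem_fil hpb⟩, ?_⟩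
    ext e
    change ((rep hG (AdjoinRoot.mk (ext S G) p)).coeff e.1.1).coeff e.1.2 = _
    rw [hrep, hp, finsetSum_coeff, finsetSum_coeff, Finset.sum_eq_single e]
    · simp
    · intro e' _ hne
      rw [coeff_monomial]
      split_ifs with h1
      · rw [coeff_monomial, if_neg]
        intro h2
        exact hne (Subtype.ext (Sigma.ext h1 (heq_of_eq h2)))
      · simp
    · simp

lemma finrank_fil [Nontrivial S] (hG : Good G) (T : Submodule K S) (m : ℕ)
    [FiniteDimensional K T] :
    Module.finrank K (fil G T m) = (exps G.natDegree m).card * Module.finrank K T := by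
  rw [(filEquiv hG T m).finrank_eq, Module.finrank_pi_fintype]
  simp

lemma finiteDimensional_fil [Nontrivial S] (hG : Good G) (T : Submodule K S) (m : ℕ)
    [FiniteDimensional K T] : FiniteDimensional K (fil G T m) :=
  (filEquiv hG T m).symm.finiteDimensional

end

section

section Eval

variable {K R R' : Type*} [Field K] [CommRing R] [Algebra K R] [CommRing R'] [Algebra K R']

/-- Evaluation of a bivariate polynomial at a point. -/
noncomputable def evalAt (u v : R) : K[X][X] →+* R := eval₂RingHom (aeval u).toRingHom v

lemma evalAt_apply (u v : R) (p : K[X][X]) :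
    evalAt u v p = ∑ j ∈ Finset.range (p.natDegree + 1), aeval u (p.coeff j) * v ^ j := by
  simp [evalAt, eval₂_eq_sum_range]

lemma map_evalAt (φ : R →ₐ[K] R') (u v : R) (p : K[X][X]) :
    φ (evalAt u v p) = evalAt (φ u) (φ v) p := by
  simp [evalAt_apply, aeval_algHom_apply]

@[simp] lemma evalAt_C (u v : R) (p : K[X]) : evalAt u v (C p) = aeval u p := by
  simp [evalAt]

@[simp] lemma evalAt_X (u v : R) : evalAt (K := K) u v X = v := by
  simp [evalAt]

/-- The divided difference of `G` in the second variable. -/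
noncomputable def divDiff (G : K[X][X]) (u v v' : R) : R :=
  ∑ j ∈ Finset.range (G.natDegree + 1), aeval u (G.coeff j) *
    ∑ t ∈ Finset.range j, v ^ t * v' ^ (j - 1 - t)

lemma map_divDiff (φ : R →ₐ[K] R') (G : K[X][X]) (u v v' : R) :
    φ (divDiff G u v v') = divDiff G (φ u) (φ v) (φ v') := by
  simp [divDiff, aeval_algHom_apply]

lemma sub_dvd_divDiff_mul {G : K[X][X]} {u v u' v' : R} (h : evalAt u v G = 0)
    (h' : evalAt u' v' G = 0) : u - u' ∣ divDiff G u v v' * (v - v') := by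
  have h1 : divDiff G u v v' * (v - v') = evalAt u v G - evalAt u v' G := by
    rw [divDiff, evalAt_apply, evalAt_apply, ← Finset.sum_sub_distrib, Finset.sum_mul]
    exact Finset.sum_congr rfl fun j _ => by rw [mul_assoc, geom_sum₂_mul, mul_sub]
  have h2 : divDiff G u v v' * (v - v') = - (evalAt u v' G - evalAt u' v' G) := by
    rw [h1, h, h']; ring
  rw [h2, dvd_neg, evalAt_apply, evalAt_apply, ← Finset.sum_sub_distrib]
  refine Finset.dvd_sum fun j _ => ?_
  rw [← sub_mul]
  refine Dvd.dvd.mul_right ?_ _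
  have := sub_dvd_eval_sub u u' ((G.coeff j).map (algebraMap K R))
  simpa [eval_map_algebraMap] using this

lemma divDiff_self (G : K[X][X]) (u v : R) : divDiff G u v v = evalAt u v (derivative G) := by
  rw [derivative_apply, sum_over_range _ (by simp), map_sum, divDiff]
  refine Finset.sum_congr rfl fun j _ => ?_
  have h : ∀ t ∈ Finset.range j, v ^ t * v ^ (j - 1 - t) = v ^ (j - 1) := fun t ht => by
    rw [Finset.mem_range] at ht
    rw [← pow_add]
    congr 1
    omega
  rw [Finset.sum_congr rfl h]
  simp [mul_assoc]

end Eval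

section Hom

variable {K S R : Type*} [Field K] [CommRing S] [Algebra K S] [CommRing R]
  [Algebra K R] {G : K[X][X]}

/-- Specialisation of the coordinate ring at a point of the curve. -/
noncomputable def spec (φ : S →ₐ[K] R) (u v : R) (h : evalAt u v G = 0) :
    CoordRing S G →+* R :=
  AdjoinRoot.lift (eval₂RingHom φ.toRingHom u) v (by
    rw [← h, eval₂_map, evalAt]
    congr 1
    ext a <;> simp)

@[simp] lemma spec_sc (φ : S →ₐ[K] R) (u v : R) (h : evalAt u v G = 0) (t : S) :
    spec φ u v h (sc G t) = φ t := by
  simp [spec, sc]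

@[simp] lemma spec_xc (φ : S →ₐ[K] R) (u v : R) (h : evalAt u v G = 0) :
    spec φ u v h (xc S G) = u := by
  simp [spec, xc]

@[simp] lemma spec_yc (φ : S →ₐ[K] R) (u v : R) (h : evalAt u v G = 0) :
    spec φ u v h (yc S G) = v := by
  simp [spec, yc]

lemma algebraMap_coordRing (c : K) :
    algebraMap K (CoordRing S G) c = sc G (algebraMap K S c) := rfl

/-- The inclusion of scalars as an algebra homomorphism. -/
noncomputable def scHom (G : K[X][X]) : S →ₐ[K] CoordRing S G where
  __ := sc G
  commutes' _ := rfl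

/-- `spec` as an algebra homomorphism. -/
noncomputable def specHom (φ : S →ₐ[K] R) (u v : R) (h : evalAt u v G = 0) :
    CoordRing S G →ₐ[K] R where
  __ := spec φ u v h
  commutes' c := by
    change spec φ u v h (algebraMap K (CoordRing S G) c) = _
    rw [algebraMap_coordRing, spec_sc, φ.commutes]

lemma evalAt_coord : evalAt (xc S G) (yc S G) G = 0 := by
  have h : evalAt (xc S G) (yc S G) = (AdjoinRoot.mk (ext S G)).comp
      (mapRingHom (mapRingHom (algebraMap K S))) := by
    ext a
    · simp [algebraMap_coordRing, sc]
    · simp [xc]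
    · simp [yc]
  rw [h, RingHom.comp_apply, coe_mapRingHom]
  exact AdjoinRoot.mk_self

lemma evalAt_sc {u v : S} (h : evalAt u v G = 0) : evalAt (sc G u) (sc G v) G = 0 := by
  have := map_evalAt (scHom (S := S) G) u v G
  rw [h, map_zero] at this
  exact this.symm

end Hom
end

section

variable {K : Type*} [Field K] (G : K[X][X])

/-- The degree filtration of the coordinate ring. -/
noncomputable abbrev flt (r : ℕ) : Submodule K (CoordRing K G) := fil G (⊤ : Submodule K K) r

/-- The coordinate ring of the square of the curve. -/
abbrev Sq : Type _ := CoordRing (CoordRing K G) G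

/-- The first coordinate of the first point. -/
noncomputable abbrev x₁ : Sq G := xc (CoordRing K G) G
/-- The second coordinate of the first point. -/
noncomputable abbrev y₁ : Sq G := yc (CoordRing K G) G
/-- The first coordinate of the second point. -/
noncomputable abbrev x₂ : Sq G := sc G (xc K G)
/-- The second coordinate of the second point. -/
noncomputable abbrev y₂ : Sq G := sc G (yc K G)

/-- The bidegree filtration of the coordinate ring of the square of the curve. -/
noncomputable abbrev bi (m r : ℕ) : Submodule K (Sq G) := fil G (flt G r) m

/-- The total degree filtration of the coordinate ring of the square of the curve. -/
noncomputable def tot (R : ℕ) : Submodule K (Sq G) :=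
  Submodule.span K {N | ∃ r i j, ∃ t ∈ flt G r, r + i + j ≤ R ∧ N = sc G t * x₁ G ^ i * y₁ G ^ j}

/-- The divided difference of the equation at the two points. -/
noncomputable def vv : Sq G := divDiff G (x₁ G) (y₁ G) (y₂ G)

/-- The ideal generated by the divided difference and `x₁ - x₂`. -/
noncomputable def jj : Ideal (Sq G) := Ideal.span {vv G, x₁ G - x₂ G}

/-- Restriction to the diagonal. -/
noncomputable def diag : Sq G →ₐ[K] CoordRing K G :=
  specHom (AlgHom.id K _) (xc K G) (yc K G) evalAt_coord

/-- The derivative of the equation in the second variable, on the curve. -/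
noncomputable def dd : CoordRing K G := evalAt (xc K G) (yc K G) (derivative G)

variable {G}

@[simp] lemma diag_x₁ : diag G (x₁ G) = xc K G := spec_xc _ _ _ evalAt_coord
@[simp] lemma diag_y₁ : diag G (y₁ G) = yc K G := spec_yc _ _ _ evalAt_coord
@[simp] lemma diag_sc (t : CoordRing K G) : diag G (sc G t) = t := spec_sc _ _ _ evalAt_coord _

lemma diag_vv : diag G (vv G) = dd G := by
  rw [vv, map_divDiff, diag_x₁, diag_y₁, diag_sc, divDiff_self, dd]

lemma flt_mono {r s : ℕ} (h : r ≤ s) : flt G r ≤ flt G s := fil_mono le_rfl h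

lemma mul_mem_flt {r s m : ℕ} (h : r + s ≤ m) {t u : CoordRing K G} (ht : t ∈ flt G r)
    (hu : u ∈ flt G s) : t * u ∈ flt G m := mul_mem_fil le_top h ht hu

lemma flt_mul_le (r s : ℕ) : flt G r * flt G s ≤ flt G (r + s) :=
  Submodule.mul_le.2 fun _ ht _ hu => mul_mem_flt le_rfl ht hu

lemma xy_mem_flt {i j m : ℕ} (h : i + j ≤ m) : xc K G ^ i * yc K G ^ j ∈ flt G m := by
  have := monomial_mem_fil (S := K) (G := G) (T := ⊤) (t := 1) trivial h
  rwa [map_one, one_mul] at this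

lemma algebraMap_mem_flt (c : K) (m : ℕ) : algebraMap K (CoordRing K G) c ∈ flt G m := by
  have := monomial_mem_fil (S := K) (G := G) (T := ⊤) (t := c) (i := 0) (j := 0) trivial
    (Nat.zero_le m)
  rwa [pow_zero, pow_zero, mul_one, mul_one] at this

lemma pow_mem_flt {t : CoordRing K G} {r : ℕ} (ht : t ∈ flt G r) (n : ℕ) :
    t ^ n ∈ flt G (r * n) := by
  induction n with
  | zero => simpa using algebraMap_mem_flt (G := G) 1 _
  | succ n ih => rw [pow_succ]; exact mul_mem_flt (by rw [Nat.mul_succ]) ih ht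

lemma mul_mem_bi {m r m' r' m'' r'' : ℕ} (hm : m + m' ≤ m'') (hr : r + r' ≤ r'') {N N' : Sq G}
    (h : N ∈ bi G m r) (h' : N' ∈ bi G m' r') : N * N' ∈ bi G m'' r'' :=
  mul_mem_fil ((flt_mul_le r r').trans (flt_mono hr)) hm h h'

lemma mem_tot {r i j R : ℕ} {t : CoordRing K G} (ht : t ∈ flt G r) (h : r + i + j ≤ R) :
    sc G t * x₁ G ^ i * y₁ G ^ j ∈ tot G R :=
  Submodule.subset_span ⟨r, i, j, t, ht, h, rfl⟩

lemma mul_mem_tot {R R' : ℕ} {N N' : Sq G} (h : N ∈ tot G R) (h' : N' ∈ tot G R') :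
    N * N' ∈ tot G (R + R') := by
  have := Submodule.mul_mem_mul h h'
  rw [tot, tot, Submodule.span_mul_span] at this
  refine Submodule.span_le.2 ?_ this
  rintro _ ⟨_, ⟨r, i, j, t, ht, hR, rfl⟩, _, ⟨r', i', j', t', ht', hR', rfl⟩, rfl⟩
  have h1 := mem_tot (mul_mem_flt le_rfl ht ht') (i := i + i') (j := j + j') (R := R + R')
    (by omega)
  refine (congrArg (· ∈ tot G (R + R')) ?_).mp h1
  rw [map_mul, pow_add, pow_add]
  ring

lemma one_mem_tot (R : ℕ) : (1 : Sq G) ∈ tot G R := by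
  have := mem_tot (G := G) (algebraMap_mem_flt 1 0) (i := 0) (j := 0) (Nat.zero_le R)
  simpa using this

lemma pow_mem_tot {R : ℕ} {N : Sq G} (h : N ∈ tot G R) (l : ℕ) : N ^ l ∈ tot G (R * l) := by
  induction l with
  | zero => simpa using one_mem_tot (G := G) 0
  | succ l ih => rw [pow_succ, Nat.mul_succ]; exact mul_mem_tot ih h

lemma vv_mem_tot (hG : Good G) : vv G ∈ tot G (G.natDegree - 1) := by
  rw [vv, divDiff]
  refine Submodule.sum_mem _ fun j _ => ?_
  rw [Finset.mul_sum]
  refine Submodule.sum_mem _ fun t ht => ?_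
  rw [Finset.mem_range] at ht
  rw [aeval_eq_sum_range, Finset.sum_mul]
  refine Submodule.sum_mem _ fun i _ => ?_
  rw [smul_mul_assoc]
  by_cases h : i + j ≤ G.natDegree
  · refine Submodule.smul_mem _ _ ?_
    have h1 : yc K G ^ (j - 1 - t) ∈ flt G (j - 1 - t) := by
      simpa using xy_mem_flt (G := G) (i := 0) (j := j - 1 - t) (by omega : _ ≤ j - 1 - t)
    have h2 := mem_tot h1 (i := i) (j := t) (R := G.natDegree - 1) (by omega)
    refine (congrArg (· ∈ tot G (G.natDegree - 1)) ?_).mp h2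
    rw [map_pow]
    ring
  · rw [(hG.mem_boxed i j).2 (by omega), zero_smul]
    exact Submodule.zero_mem _

lemma exists_bi_sub_mem [Nontrivial (CoordRing K G)] (hG : Good G) {R l : ℕ} {N : Sq G}
    (hN : N ∈ tot G R) :
    ∃ W ∈ bi G (l + (G.natDegree - 1)) R, N - W ∈ Ideal.span {(x₁ G - x₂ G) ^ (l + 1)} := by
  set I := Ideal.span {(x₁ G - x₂ G) ^ (l + 1)} with hI
  set T : Submodule K (Sq G) := bi G (l + (G.natDegree - 1)) R ⊔ I.restrictScalars K with hT
  suffices N ∈ T by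
    obtain ⟨W, hW, Z, hZ, rfl⟩ := Submodule.mem_sup.1 this
    exact ⟨W, hW, by simpa using hZ⟩
  have key : ∀ i r j, ∀ t ∈ flt G r, r + i + j ≤ R → j < G.natDegree →
      sc G t * x₁ G ^ i * y₁ G ^ j ∈ T := by
    intro i
    induction i using Nat.strong_induction_on with
    | _ i ih =>
    intro r j t ht hR hj
    by_cases hi : i ≤ l
    · exact Submodule.mem_sup_left (monomial_mem_fil (flt_mono (by omega) ht) (by omega))
    obtain ⟨e, rfl⟩ := Nat.exists_eq_add_of_lt (not_le.1 hi)
    have h1 : x₁ G ^ (l + 1) = (x₁ G - x₂ G) ^ (l + 1) -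
        ∑ u ∈ Finset.range (l + 1), x₁ G ^ u * (-x₂ G) ^ (l + 1 - u) *
          ((l + 1).choose u : Sq G) := by
      rw [sub_eq_add_neg (x₁ G), add_pow, Finset.sum_range_succ _ (l + 1)]
      simp
    have h2 : sc G t * x₁ G ^ (l + e + 1) * y₁ G ^ j =
        sc G t * x₁ G ^ e * y₁ G ^ j * (x₁ G - x₂ G) ^ (l + 1) -
        ∑ u ∈ Finset.range (l + 1), ((-1) ^ (l + 1 - u) * (l + 1).choose u : K) •
          (sc G (t * xc K G ^ (l + 1 - u)) * x₁ G ^ (e + u) * y₁ G ^ j) := by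
      have h3 : x₁ G ^ (l + e + 1) = x₁ G ^ e * x₁ G ^ (l + 1) := by rw [← pow_add]; congr 1; omega
      rw [h3, h1, mul_sub, mul_sub, sub_mul, Finset.mul_sum, Finset.mul_sum, Finset.sum_mul]
      congr 1
      · ring
      · refine Finset.sum_congr rfl fun u _ => ?_
        rw [Algebra.smul_def, map_mul, map_mul, map_pow, map_pow, map_neg, map_one, map_natCast,
          neg_pow, pow_add]
        ring
    rw [h2]
    refine Submodule.sub_mem _ (Submodule.mem_sup_right ?_) (Submodule.sum_mem _ fun u hu =>
      Submodule.smul_mem _ _ ?_)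
    · exact Ideal.mul_mem_left _ _ (Ideal.mem_span_singleton_self _)
    · rw [Finset.mem_range] at hu
      refine ih (e + u) (by omega) (r + (l + 1 - u)) j _ (mul_mem_flt le_rfl ht ?_) (by omega) hj
      simpa using xy_mem_flt (G := G) (i := l + 1 - u) (j := 0) (by omega : _ ≤ l + 1 - u)
  refine Submodule.span_le.2 ?_ hN
  rintro _ ⟨r, i, j, t, ht, hR, rfl⟩
  have h1 : x₁ G ^ i * y₁ G ^ j ∈ fil G (1 : Submodule K (CoordRing K G)) (i + j) := by
    have := monomial_mem_fil (G := G) (T := (1 : Submodule K (CoordRing K G))) (t := 1)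
      (Submodule.mem_one.2 ⟨1, map_one _⟩) (le_refl (i + j))
    rwa [map_one, one_mul] at this
  rw [mul_assoc]
  refine fil_induction hG (P := fun N => sc G t * N ∈ T) h1 (by simp)
    (fun a b ha hb => by rw [mul_add]; exact T.add_mem ha hb) fun i' j' c hc hij hj => ?_
  obtain ⟨c, rfl⟩ := Submodule.mem_one.1 hc
  rw [← mul_assoc, ← mul_assoc, ← map_mul]
  refine key i' r j' _ ?_ (by omega) hj
  rw [mul_comm, ← Algebra.smul_def]
  exact Submodule.smul_mem _ _ ht

lemma diag_sub : diag G (x₁ G - x₂ G) = 0 := by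
  rw [map_sub, diag_x₁, diag_sc, sub_self]

lemma exists_approx [Nontrivial (CoordRing K G)] (hG : Good G) (l : ℕ) :
    ∃ W ∈ bi G (l + (G.natDegree - 1)) ((G.natDegree - 1) * (l + 1)), W ∈ jj G ^ (l + 1) ∧
      diag G W = dd G ^ (l + 1) := by
  obtain ⟨W, hW, h⟩ := exists_bi_sub_mem hG (l := l) (pow_mem_tot (vv_mem_tot hG) (l + 1))
  refine ⟨W, hW, ?_, ?_⟩
  · have h1 : vv G ^ (l + 1) ∈ jj G ^ (l + 1) :=
      Ideal.pow_mem_pow (Ideal.subset_span (by simp)) _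
    have h2 : Ideal.span {(x₁ G - x₂ G) ^ (l + 1)} ≤ jj G ^ (l + 1) := by
      rw [Ideal.span_singleton_le_iff_mem]
      exact Ideal.pow_mem_pow (Ideal.subset_span (by simp)) _
    have := Ideal.sub_mem _ h1 (h2 h)
    simpa using this
  · obtain ⟨Z, hZ⟩ := Ideal.mem_span_singleton.1 h
    have := congrArg (diag G) hZ
    rw [map_sub, map_mul, map_pow, map_pow, diag_sub, diag_vv, zero_pow (by omega), zero_mul,
      sub_eq_zero] at this
    exact this.symm

lemma exists_diag_eq [Nontrivial (CoordRing K G)] (hG : Good G) {n b : ℕ}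
    (hn : G.natDegree ≤ n + 1) {t : CoordRing K G}
    (ht : t ∈ flt G (n + b)) : ∃ N ∈ bi G n b, diag G N = t := by
  refine fil_induction hG (P := fun t => ∃ N ∈ bi G n b, diag G N = t) ht
    ⟨0, Submodule.zero_mem _, map_zero _⟩ ?_ ?_
  · rintro _ _ ⟨N, hN, rfl⟩ ⟨N', hN', rfl⟩
    exact ⟨N + N', Submodule.add_mem _ hN hN', map_add _ _ _⟩
  · intro i j c _ hij hj
    refine ⟨sc G (sc G c * xc K G ^ (i - (n - j))) * x₁ G ^ (min i (n - j)) * y₁ G ^ j,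
      monomial_mem_fil ?_ (by omega), ?_⟩
    · have := monomial_mem_fil (S := K) (G := G) (T := ⊤) (t := c) (i := i - (n - j)) (j := 0)
        (m := b) trivial (by omega)
      rwa [pow_zero, mul_one] at this
    · rw [map_mul, map_mul, map_pow, map_pow, diag_sc, diag_x₁, diag_y₁, mul_assoc (sc G c),
        ← pow_add]
      congr 3
      omega

end

section

lemma finrank_add_le_of_le_ker {K V W : Type*} [Field K] [AddCommGroup V] [Module K V]
    [AddCommGroup W] [Module K W] (f : V →ₗ[K] W) (M P : Submodule K V) (Q : Submodule K W)
    [FiniteDimensional K M] (hPM : P ≤ M) (hP : P ≤ LinearMap.ker f) (hQ : Q ≤ M.map f) :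
    Module.finrank K P + Module.finrank K Q ≤ Module.finrank K M := by
  have h1 := LinearMap.finrank_range_add_finrank_ker (f.domRestrict M)
  have h2 : LinearMap.range (f.domRestrict M) = M.map f := by
    rw [LinearMap.range_domRestrict]
  have h3 : Module.finrank K Q ≤ Module.finrank K (LinearMap.range (f.domRestrict M)) := by
    rw [h2]
    exact Submodule.finrank_mono hQ
  have h4 : Module.finrank K P ≤ Module.finrank K (LinearMap.ker (f.domRestrict M)) := by
    refine LinearMap.finrank_le_finrank_of_injective (f :=
      (Submodule.inclusion hPM).codRestrict (LinearMap.ker (f.domRestrict M)) fun p => ?_) ?_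
    · exact hP p.2
    · intro p p' h
      exact Submodule.inclusion_injective hPM (congrArg Subtype.val h)
  omega

variable {K : Type*} [Field K] {G : K[X][X]}

variable (G) in
/-- Elements of bounded bidegree in a power of the ideal `jj G`. -/
noncomputable def nn (a b l : ℕ) : Submodule K (Sq G) :=
  (jj G ^ l).restrictScalars K ⊓ bi G (a + l) (b + l)

lemma finrank_flt (hG : Good G) (r : ℕ) :
    Module.finrank K (flt G r) = (exps G.natDegree r).card := by
  rw [flt, finrank_fil hG]
  simp

lemma finiteDimensional_flt (hG : Good G) (r : ℕ) : FiniteDimensional K (flt G r) :=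
  finiteDimensional_fil hG _ _

lemma finiteDimensional_bi [Nontrivial (CoordRing K G)] (hG : Good G) (m r : ℕ) :
    FiniteDimensional K (bi G m r) :=
  have := finiteDimensional_flt hG r
  finiteDimensional_fil hG _ _

lemma finrank_bi [Nontrivial (CoordRing K G)] (hG : Good G) (m r : ℕ) :
    Module.finrank K (bi G m r) = (exps G.natDegree m).card * (exps G.natDegree r).card := by
  have := finiteDimensional_flt hG r
  rw [bi, finrank_fil hG, finrank_flt hG]

lemma finiteDimensional_nn [Nontrivial (CoordRing K G)] (hG : Good G) (a b l : ℕ) :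
    FiniteDimensional K (nn G a b l) :=
  have := finiteDimensional_bi hG (a + l) (b + l)
  Submodule.finiteDimensional_of_le inf_le_right

lemma x_sub_mem_bi : x₁ G - x₂ G ∈ bi G 1 1 := by
  refine Submodule.sub_mem _ ?_ ?_
  · have := monomial_mem_fil (G := G) (T := flt G 1) (t := 1) (i := 1) (j := 0) (m := 1)
      (by simpa using algebraMap_mem_flt (G := G) 1 1) le_rfl
    simpa using this
  · have := monomial_mem_fil (G := G) (T := flt G 1) (t := xc K G) (i := 0) (j := 0) (m := 1)
      (by simpa using xy_mem_flt (G := G) (i := 1) (j := 0) le_rfl) (by omega)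
    simpa using this

lemma le_finrank_nn_succ [IsDomain (CoordRing K G)] (hG : Good G) (hd : dd G ≠ 0) {n b l : ℕ}
    (hn : G.natDegree ≤ n + 1) (hb : (G.natDegree - 1) * (l + 1) ≤ b) :
    Module.finrank K (nn G (n + (G.natDegree - 1)) b l) +
      (exps G.natDegree (n + (b - (G.natDegree - 1) * (l + 1)))).card ≤
      Module.finrank K (nn G (n + (G.natDegree - 1)) b (l + 1)) := by
  set a := n + (G.natDegree - 1) with ha
  set b' := b - (G.natDegree - 1) * (l + 1) with hb'
  have := finiteDimensional_nn hG a b (l + 1)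
  have := finiteDimensional_nn hG a b l
  have := finiteDimensional_flt hG (n + b')
  have hX : Module.finrank K (nn G a b l) =
      Module.finrank K ((nn G a b l).map (LinearMap.mulLeft K (x₁ G - x₂ G))) :=
    (LinearEquiv.finrank_eq (Submodule.equivMapOfInjective _ (by
      rw [← LinearMap.ker_eq_bot, LinearMap.ker_eq_bot']
      exact fun N hN => sub_mul_eq_zero hG hN) _))
  have hY : Module.finrank K (flt G (n + b')) =
      Module.finrank K ((flt G (n + b')).map (LinearMap.mulLeft K (dd G ^ (l + 1)))) :=
    (LinearEquiv.finrank_eq (Submodule.equivMapOfInjective _ (by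
      rw [← LinearMap.ker_eq_bot, LinearMap.ker_eq_bot']
      exact fun N hN => (mul_eq_zero.1 hN).resolve_left (pow_ne_zero _ hd)) _))
  rw [← finrank_flt hG, hX, hY]
  refine finrank_add_le_of_le_ker (diag G).toLinearMap _ _ _ ?_ ?_ ?_
  · rintro _ ⟨N, ⟨hN1, hN2⟩, rfl⟩
    refine ⟨?_, ?_⟩
    · change (x₁ G - x₂ G) * N ∈ jj G ^ (l + 1)
      rw [pow_succ']
      exact Ideal.mul_mem_mul (Ideal.subset_span (by simp)) hN1
    · exact mul_mem_bi (by omega) (by omega) x_sub_mem_bi hN2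
  · rintro _ ⟨N, hN, rfl⟩
    simp only [LinearMap.mem_ker, LinearMap.mulLeft_apply, AlgHom.toLinearMap_apply, map_mul,
      diag_sub, zero_mul]
  · rintro _ ⟨t, ht, rfl⟩
    obtain ⟨W, hW, hWJ, hWd⟩ := exists_approx hG l
    obtain ⟨N, hN, hNt⟩ := exists_diag_eq hG hn ht
    refine ⟨W * N, ⟨Ideal.mul_mem_right _ _ hWJ, mul_mem_bi ?_ ?_ hW hN⟩, ?_⟩
    · omega
    · omega
    · rw [AlgHom.toLinearMap_apply, map_mul, hWd, hNt, LinearMap.mulLeft_apply]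

lemma le_finrank_nn [IsDomain (CoordRing K G)] (hG : Good G) (hd : dd G ≠ 0) {n b k : ℕ}
    (hn : G.natDegree ≤ n + 1) (hb : (G.natDegree - 1) * k ≤ b) :
    (exps G.natDegree (n + (G.natDegree - 1))).card * (exps G.natDegree b).card +
      ∑ l ∈ Finset.range k, (exps G.natDegree (n + (b - (G.natDegree - 1) * (l + 1)))).card ≤
      Module.finrank K (nn G (n + (G.natDegree - 1)) b k) := by
  induction k with
  | zero =>
    have : nn G (n + (G.natDegree - 1)) b 0 = bi G (n + (G.natDegree - 1)) b := by
      simp [nn, Ideal.one_eq_top]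
    rw [this, finrank_bi hG]
    simp
  | succ k ih =>
    rw [Finset.sum_range_succ, ← add_assoc]
    exact (Nat.add_le_add_right (ih (le_trans (Nat.mul_le_mul_left _ (by omega)) hb)) _).trans
      (le_finrank_nn_succ hG hd hn hb)

end

section

universe u

lemma rank_le_add_of_map_le {R : Type*} {V W : Type u} [CommRing R] [IsDomain R] [AddCommGroup V]
    [Module R V] [AddCommGroup W] [Module R W]
    {r s : ℕ} (f : V →ₗ[R] W) (M E : Submodule R V) (φ ψ : V →ₗ[R] V)
    (hφ : Function.Injective φ)
    (h : ∀ N ∈ M, f N = 0 → φ N ∈ E.map ψ) (hE : Module.rank R E ≤ r)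
    (hW : Module.rank R W ≤ s) : Module.rank R M ≤ (r + s : ℕ) := by
  have h1 := LinearMap.rank_range_add_rank_ker (f.domRestrict M)
  have h2 : Module.rank R (LinearMap.range (f.domRestrict M)) ≤ s :=
    (Submodule.rank_le _).trans hW
  have h3 : Module.rank R (LinearMap.ker (f.domRestrict M)) ≤ Module.rank R (E.map ψ) := by
    refine LinearMap.rank_le_of_injective ((φ.comp (M.subtype.comp
      (LinearMap.ker (f.domRestrict M)).subtype)).codRestrict (E.map ψ) fun N =>
        h N.1.1 N.1.2 N.2) ?_
    intro N N' hN
    exact Subtype.ext (Subtype.ext (hφ (congrArg Subtype.val hN)))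
  have h4 : Module.rank R (E.map ψ) ≤ r := (rank_map_le ψ E).trans hE
  rw [← h1, Nat.cast_add, add_comm]
  exact add_le_add (h3.trans h4) h2

variable {K : Type*} [Field K] {G : K[X][X]}

lemma smul_sq (p : K[X]) (N : Sq G) : p • N = sc G (AdjoinRoot.mk (ext K G) (C p)) * N := by
  rw [Algebra.smul_def]; rfl

variable (G) in
/-- Elements of bounded degree in the first point lying in a power of the ideal `jj G`. -/
noncomputable def ee (a l : ℕ) : Submodule K[X] (Sq G) where
  carrier := {N | N ∈ jj G ^ l ∧ N ∈ fil G (⊤ : Submodule K (CoordRing K G)) (a + l)}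
  add_mem' := fun h h' => ⟨Ideal.add_mem _ h.1 h'.1, Submodule.add_mem _ h.2 h'.2⟩
  zero_mem' := ⟨Ideal.zero_mem _, Submodule.zero_mem _⟩
  smul_mem' := fun p N h => by
    rw [smul_sq]
    refine ⟨Ideal.mul_mem_left _ _ h.1, ?_⟩
    refine mul_mem_fil (T := ⊤) (m := 0) le_top (by omega) ?_ h.2
    have := monomial_mem_fil (G := G) (T := (⊤ : Submodule K (CoordRing K G))) (m := 0) (i := 0)
      (j := 0) (t := AdjoinRoot.mk (ext K G) (C p)) trivial le_rfl
    simpa using this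

lemma rank_coordRing (hG : Good G) : Module.rank K[X] (CoordRing K G) = G.natDegree := by
  rw [rank_eq_card_basis (AdjoinRoot.powerBasis' (hG.ext_monic (S := K))).basis,
    AdjoinRoot.powerBasis'_dim, hG.natDegree_ext]
  simp

/-- Restriction to the diagonal as a linear map over the polynomials in `x₂`. -/
noncomputable def diagLin : Sq G →ₗ[K[X]] CoordRing K G where
  toFun := diag G
  map_add' := map_add _
  map_smul' p N := by
    rw [smul_sq, map_mul, diag_sc, RingHom.id_apply, Algebra.smul_def]
    rfl

lemma rank_ee_zero [Nontrivial (CoordRing K G)] (hG : Good G) (a : ℕ) :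
    Module.rank K[X] (ee G a 0) ≤ ((exps G.natDegree a).card * G.natDegree : ℕ) := by
  have h := LinearMap.rank_le_of_injective (((coeffs (S := CoordRing K G) hG a).restrictScalars
    K[X]).comp (ee G a 0).subtype) (by
      rw [← LinearMap.ker_eq_bot, LinearMap.ker_eq_bot']
      intro N hN
      exact Subtype.ext (coeffs_injOn hG N.2.2 hN))
  refine h.trans ?_
  have : Module.Free K[X] (CoordRing K G) :=
    Module.Free.of_basis (AdjoinRoot.powerBasis' (hG.ext_monic (S := K))).basis
  rw [rank_pi]
  simp [rank_coordRing hG]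

variable (G) in
/-- The ideal of the diagonal. -/
noncomputable def mm : Ideal (Sq G) := Ideal.span {x₁ G - x₂ G, y₁ G - y₂ G}

lemma sub_diag_mem [Nontrivial (CoordRing K G)] (hG : Good G) (N : Sq G) :
    N - sc G (diag G N) ∈ mm G := by
  obtain ⟨m, hm⟩ := exists_mem_fil (K := K) N
  refine fil_induction hG (P := fun N => N - sc G (diag G N) ∈ mm G) hm (by simp) ?_ ?_
  · intro a b ha hb
    have := Ideal.add_mem _ ha hb
    rwa [sub_add_sub_comm, ← map_add, ← map_add] at this
  · intro i j t _ _ _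
    have h1 : diag G (xc (CoordRing K G) G) = xc K G := diag_x₁
    have h2 : diag G (yc (CoordRing K G) G) = yc K G := diag_y₁
    simp only [map_mul, map_pow, diag_sc, h1, h2]
    change sc G t * x₁ G ^ i * y₁ G ^ j - sc G t * x₂ G ^ i * y₂ G ^ j ∈ mm G
    rw [← Ideal.Quotient.eq]
    have hx : Ideal.Quotient.mk (mm G) (x₁ G) = Ideal.Quotient.mk (mm G) (x₂ G) :=
      Ideal.Quotient.eq.2 (Ideal.subset_span (by simp))
    have hy : Ideal.Quotient.mk (mm G) (y₁ G) = Ideal.Quotient.mk (mm G) (y₂ G) :=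
      Ideal.Quotient.eq.2 (Ideal.subset_span (by simp))
    simp only [map_mul, map_pow]
    rw [hx, hy]

lemma vv_mul_y_sub : x₁ G - x₂ G ∣ vv G * (y₁ G - y₂ G) :=
  sub_dvd_divDiff_mul evalAt_coord (evalAt_sc evalAt_coord)

lemma mm_mul_vv_le : mm G * Ideal.span {vv G} ≤ Ideal.span {x₁ G - x₂ G} := by
  rw [mm, Ideal.span_mul_span', Ideal.span_le]
  rintro _ ⟨z, hz, w, hw, rfl⟩
  rw [Set.mem_singleton_iff] at hw
  subst hw
  simp only [SetLike.mem_coe, Ideal.mem_span_singleton]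
  rcases hz with rfl | rfl
  · exact dvd_mul_right _ _
  · rw [mul_comm]; exact vv_mul_y_sub

lemma mm_mul_jj_le : mm G * jj G ≤ Ideal.span {x₁ G - x₂ G} := by
  rw [jj, Ideal.span_insert, Ideal.mul_sup]
  exact sup_le mm_mul_vv_le Ideal.mul_le_right

lemma exists_eq_mul_of_diag_eq_zero [Nontrivial (CoordRing K G)] (hG : Good G) {l : ℕ} {N : Sq G}
    (hN : N ∈ jj G ^ (l + 1)) (h0 : diag G N = 0) :
    ∃ M ∈ jj G ^ l, (x₁ G - x₂ G) * M = sc G (dd G) ^ (l + 1) * N := by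
  rw [← Ideal.mem_span_singleton_mul]
  have hNm : N ∈ mm G := by simpa [h0] using sub_diag_mem hG N
  have hv : vv G - sc G (dd G) ∈ mm G := by
    have := sub_diag_mem hG (vv G)
    rwa [diag_vv] at this
  have h1 : vv G ^ (l + 1) - sc G (dd G) ^ (l + 1) ∈ mm G :=
    (mm G).mem_of_dvd (sub_dvd_pow_sub_pow _ _ _) hv
  have h2 : (vv G ^ (l + 1) - sc G (dd G) ^ (l + 1)) * N ∈
      Ideal.span {x₁ G - x₂ G} * jj G ^ l := by
    have := Ideal.mul_mem_mul h1 hN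
    rw [pow_succ', ← mul_assoc] at this
    exact Ideal.mul_mono_left mm_mul_jj_le this
  have h3 : vv G ^ (l + 1) * N ∈ Ideal.span {x₁ G - x₂ G} * jj G ^ l := by
    have h4 := Ideal.mul_mem_mul (mm_mul_vv_le (Ideal.mul_mem_mul hNm
      (Ideal.mem_span_singleton_self (vv G))))
      (Ideal.pow_mem_pow (Ideal.subset_span (by simp) : vv G ∈ jj G) l)
    refine (congrArg (· ∈ Ideal.span {x₁ G - x₂ G} * jj G ^ l) ?_).mp h4
    ring
  have := Ideal.sub_mem _ h3 h2
  rwa [← sub_mul, sub_sub_cancel] at this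

lemma sc_mul_injective [IsDomain (CoordRing K G)] (hG : Good G) {t : CoordRing K G} (ht : t ≠ 0)
    {N : Sq G} (h : sc G t * N = 0) : N = 0 := by
  apply rep_injective hG
  ext1 j
  ext1 i
  have := rep_sc_mul hG t N i j
  rw [h, map_zero, coeff_zero, coeff_zero, zero_eq_mul] at this
  rw [map_zero, coeff_zero, coeff_zero, this.resolve_left ht]

lemma rank_ee [IsDomain (CoordRing K G)] (hG : Good G) (hd : dd G ≠ 0) (a l : ℕ) :
    Module.rank K[X] (ee G a l) ≤
      ((exps G.natDegree a).card * G.natDegree + l * G.natDegree : ℕ) := by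
  induction l with
  | zero => simpa using rank_ee_zero hG a
  | succ l ih =>
    have := rank_le_add_of_map_le (diagLin (G := G)) (ee G a (l + 1)) (ee G a l)
      (LinearMap.mulLeft K[X] (sc G (dd G ^ (l + 1)))) (LinearMap.mulLeft K[X] (x₁ G - x₂ G))
      ?_ ?_ ih (rank_coordRing hG).le
    · rwa [add_assoc, ← Nat.succ_mul] at this
    · rw [← LinearMap.ker_eq_bot, LinearMap.ker_eq_bot']
      exact fun N hN => sc_mul_injective hG (pow_ne_zero _ hd) hN
    · intro N hN h0
      obtain ⟨M, hM, hMN⟩ := exists_eq_mul_of_diag_eq_zero hG hN.1 h0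
      rw [← map_pow] at hMN
      refine ⟨M, ⟨hM, ?_⟩, hMN⟩
      refine mem_fil_of_sub_mul_mem hG (c := xc K G) ?_
      change (x₁ G - x₂ G) * M ∈ _
      rw [hMN]
      refine mul_mem_fil (T := ⊤) (m := 0) le_top (by omega) ?_ hN.2
      have := monomial_mem_fil (G := G) (T := (⊤ : Submodule K (CoordRing K G))) (m := 0) (i := 0)
        (j := 0) (t := dd G ^ (l + 1)) trivial le_rfl
      simpa using this

end

section

section Lowering

variable {K V : Type*} [Field K] [AddCommGroup V] [Module K V] [Module K[X] V]

lemma eq_sum_of_coeff_eq_zero {p : K[X]} {e : ℕ} (hp : ∀ k, e ≤ k → p.coeff k = 0) :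
    p = ∑ k ∈ Finset.range e, C (p.coeff k) * X ^ k := by
  ext k
  rw [finsetSum_coeff]
  simp only [coeff_C_mul_X_pow]
  rw [Finset.sum_ite_eq]
  split_ifs with h
  · rfl
  · exact hp k (by simpa using h)

lemma pow_smul_mem {M : ℕ → Submodule K V}
    (hX : ∀ r, ∀ m ∈ M r, (X : K[X]) • m ∈ M (r + 1)) {r : ℕ} {m : V} (hm : m ∈ M r) (k : ℕ) :
    (X ^ k : K[X]) • m ∈ M (r + k) := by
  induction k with
  | zero => simpa using hm
  | succ k ih => rw [pow_succ', mul_smul]; exact hX _ _ ih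

variable [IsScalarTower K K[X] V]

lemma smul_mem_of_coeff_eq_zero {M : ℕ → Submodule K V} (hmono : Monotone M)
    (hX : ∀ r, ∀ m ∈ M r, (X : K[X]) • m ∈ M (r + 1)) {r e : ℕ} {m : V} (hm : m ∈ M (r + 1))
    {p : K[X]} (hp : ∀ k, e ≤ k → p.coeff k = 0) : p • m ∈ M (r + e) := by
  rw [eq_sum_of_coeff_eq_zero hp, Finset.sum_smul]
  refine Submodule.sum_mem _ fun k hk => ?_
  rw [Finset.mem_range] at hk
  rw [← smul_eq_C_mul, smul_assoc]
  exact Submodule.smul_mem _ _ (hmono (by omega) (pow_smul_mem hX hm k))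

lemma finrank_succ_le (E : Submodule K[X] V) (M : ℕ → Submodule K V) (hmono : Monotone M)
    (hE : ∀ r, ∀ m ∈ M r, m ∈ E) (hX : ∀ r, ∀ m ∈ M r, (X : K[X]) • m ∈ M (r + 1))
    (hX' : ∀ r, ∀ m ∈ E, (X : K[X]) • m ∈ M (r + 1) → m ∈ M r)
    (hfin : ∀ r, FiniteDimensional K (M r)) {ρ : ℕ} (hρ : Module.rank K[X] E ≤ ρ) (r : ℕ) :
    Module.finrank K (M (r + 1)) ≤ Module.finrank K (M r) + ρ := by
  have := hfin (r + 1)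
  have hX'' : ∀ k r, ∀ m ∈ E, (X ^ k : K[X]) • m ∈ M (r + k) → m ∈ M r := by
    intro k
    induction k with
    | zero => intro r m _ h; simpa using h
    | succ k ih =>
      intro r m hm h
      rw [pow_succ', mul_smul] at h
      exact ih r m hm (hX' _ _ (E.smul_mem _ hm) h)
  set L : Submodule K (M (r + 1)) := (M r).comap (M (r + 1)).subtype with hL
  have hLr : Module.finrank K L = Module.finrank K (M r) :=
    (Submodule.comapSubtypeEquivOfLe (hmono (Nat.le_succ r))).finrank_eq
  have hsum := Submodule.finrank_quotient_add_finrank L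
  set s := Module.finrank K (M (r + 1) ⧸ L) with hs
  let b := Module.finBasis K (M (r + 1) ⧸ L)
  choose N hN using fun i => Submodule.Quotient.mk_surjective L (b i)
  have key : ∀ e, ∀ p : Fin s → K[X], (∀ i, ∀ k, e ≤ k → (p i).coeff k = 0) →
      ∑ i, p i • (N i : V) = 0 → ∀ i, p i = 0 := by
    intro e
    induction e with
    | zero => exact fun p hp _ i => by ext k; simpa using hp i k (Nat.zero_le k)
    | succ e ih =>
      intro p hp h0
      refine ih p (fun i k hk => ?_) h0
      obtain rfl | hlt := hk.eq_or_lt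
      swap
      · exact hp i k hlt
      have h1 : (X ^ e : K[X]) • ∑ i, (p i).coeff e • (N i : V) =
          - ∑ i, (p i - C ((p i).coeff e) * X ^ e) • (N i : V) := by
        rw [eq_neg_iff_add_eq_zero, ← h0, Finset.smul_sum, ← Finset.sum_add_distrib]
        refine Finset.sum_congr rfl fun i _ => ?_
        rw [sub_smul, ← smul_eq_C_mul, smul_assoc, smul_comm, add_sub_cancel]
      have h2 : ∑ i, (p i).coeff e • (N i : V) ∈ M r := by
        refine hX'' e r _ (hE _ _ (Submodule.sum_mem _ fun i _ =>
          Submodule.smul_mem _ _ (N i).2)) ?_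
        rw [h1]
        refine Submodule.neg_mem _ (Submodule.sum_mem _ fun i _ =>
          smul_mem_of_coeff_eq_zero hmono hX (N i).2 fun k hk => ?_)
        rw [coeff_sub, coeff_C_mul_X_pow]
        split_ifs with hke
        · rw [hke, sub_self]
        · rw [hp i k (by omega), sub_zero]
      have h3 : ∑ i, (p i).coeff e • b i = 0 := by
        simp only [← hN]
        have : (Submodule.Quotient.mk (∑ i, (p i).coeff e • N i) : M (r + 1) ⧸ L) = 0 := by
          rw [Submodule.Quotient.mk_eq_zero, hL, Submodule.mem_comap]
          simpa using h2
        rw [← this, ← Submodule.mkQ_apply, map_sum]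
        simp
      exact Fintype.linearIndependent_iff.1 b.linearIndependent _ h3 i
  have hli : LinearIndependent K[X] fun i => (⟨N i, hE _ _ (N i).2⟩ : E) := by
    rw [Fintype.linearIndependent_iff]
    intro p h0
    refine key (∑ i, ((p i).natDegree + 1)) p (fun i k hk => coeff_eq_zero_of_natDegree_lt ?_) ?_
    · have := Finset.single_le_sum (f := fun i => (p i).natDegree + 1) (fun _ _ => Nat.zero_le _)
        (Finset.mem_univ i)
      omega
    · simpa using congrArg Subtype.val h0
  have hc := hli.cardinal_lift_le_rank
  rw [Cardinal.mk_fin, Cardinal.lift_natCast] at hc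
  have hc' := hc.trans (Cardinal.lift_le.2 hρ)
  rw [Cardinal.lift_natCast, Nat.cast_le] at hc'
  omega

end Lowering

variable {K : Type*} [Field K] {G : K[X][X]}

lemma X_smul_sq (N : Sq G) : (X : K[X]) • N = x₂ G * N := smul_sq _ _

lemma mem_flt_of_x_mul_mem (hG : Good G) {t : CoordRing K G} {r : ℕ}
    (h : xc K G * t ∈ flt G (r + 1)) : t ∈ flt G r := by
  refine mem_fil_of_sub_mul_mem hG (c := 0) ?_
  rwa [map_zero, sub_zero]

lemma mem_bi_of_x₂_mul_mem [Nontrivial (CoordRing K G)] (hG : Good G) {N : Sq G} {m r : ℕ}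
    (h : x₂ G * N ∈ bi G m (r + 1)) (hN : N ∈ fil G (⊤ : Submodule K (CoordRing K G)) m) :
    N ∈ bi G m r := by
  rw [mem_fil_iff hG] at h hN ⊢
  intro i j
  refine ⟨mem_flt_of_x_mul_mem hG ?_, (hN i j).2⟩
  rw [← rep_sc_mul hG]
  exact (h i j).1

lemma x₂_mem_bi : x₂ G ∈ bi G 0 1 := by
  have := monomial_mem_fil (G := G) (T := flt G 1) (t := xc K G) (i := 0) (j := 0) (m := 0)
      (by simpa using xy_mem_flt (G := G) (i := 1) (j := 0) le_rfl) (by omega)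
  simpa using this

lemma finrank_inf_bi_le [IsDomain (CoordRing K G)] (hG : Good G) (hd : dd G ≠ 0) (a k r e : ℕ) :
    Module.finrank K ((jj G ^ k).restrictScalars K ⊓ bi G (a + k) (r + e) : Submodule K (Sq G)) ≤
    Module.finrank K ((jj G ^ k).restrictScalars K ⊓ bi G (a + k) r : Submodule K (Sq G)) +
      e * ((exps G.natDegree a).card * G.natDegree + k * G.natDegree) := by
  induction e with
  | zero => simp
  | succ e ih =>
    have := finrank_succ_le (K := K) (ee G a k)
      (fun r => (jj G ^ k).restrictScalars K ⊓ bi G (a + k) r)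
      (fun r s h => inf_le_inf le_rfl (fil_mono (flt_mono h) le_rfl))
      (fun r m hm => ⟨hm.1, fil_mono le_top le_rfl hm.2⟩)
      (fun r m hm => by
        rw [X_smul_sq]
        exact ⟨Ideal.mul_mem_left _ _ hm.1, mul_mem_bi (by omega) (by omega) x₂_mem_bi hm.2⟩)
      (fun r m hm h => by
        rw [X_smul_sq] at h
        exact ⟨hm.1, mem_bi_of_x₂_mul_mem hG h.2 hm.2⟩)
      (fun r => by
        have := finiteDimensional_bi hG (a + k) r
        exact Submodule.finiteDimensional_of_le inf_le_right)
      (rank_ee hG hd a k) (r + e)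
    rw [Nat.succ_mul]
    rw [← add_assoc] at *
    omega

end

section

lemma two_mul_sum_card_exps {D E n : ℕ} (k : ℕ) :
    2 * ∑ l ∈ Finset.range k, (exps D (n + (E * l + D))).card + k * D * D + D * E * k =
      k * (2 * D * (n + D + 1) + D) + D * E * k * k := by
  induction k with
  | zero => simp
  | succ k ih =>
    have := two_mul_card_exps (D := D) (m := n + (E * k + D)) (by omega)
    rw [Finset.sum_range_succ]
    linarith

lemma card_exps_lt {D E n k b : ℕ} (hD : D = E + 1) (hn : n = E ^ 3 + 6 * E ^ 2 + 14 * E + 10)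
    (hk : k = D ^ 2) (hb : b = E * k + D) :
    (b + 1) * ((exps D (n + E)).card * D + k * D) < (exps D (n + E)).card * (exps D b).card +
      ∑ l ∈ Finset.range k, (exps D (n + (b - E * (l + 1)))).card := by
  have h1 : ∑ l ∈ Finset.range k, (exps D (n + (b - E * (l + 1)))).card =
      ∑ l ∈ Finset.range k, (exps D (n + (E * l + D))).card := by
    rw [← Finset.sum_range_reflect]
    refine Finset.sum_congr rfl fun l hl => ?_
    rw [Finset.mem_range] at hl
    have : b = E * l + D + E * (k - 1 - l + 1) := by
      rw [hb, show k - 1 - l + 1 = k - l by omega]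
      obtain ⟨m, rfl⟩ := Nat.exists_eq_add_of_le hl.le
      rw [Nat.add_sub_cancel_left]
      ring
    rw [this, Nat.add_sub_cancel]
  rw [h1]
  have h2 := two_mul_sum_card_exps (D := D) (E := E) (n := n) k
  have h3 := two_mul_card_exps (D := D) (m := n + E) (by omega)
  have h4 := two_mul_card_exps (D := D) (m := b) (by omega)
  generalize ∑ l ∈ Finset.range k, (exps D (n + (E * l + D))).card = S at *
  generalize (exps D (n + E)).card = s at *
  generalize (exps D b).card = t at *
  have hS : (S : ℚ) =
      (k * (2 * D * (n + D + 1) + D) + D * E * k * k - k * D * D - D * E * k) / 2 := by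
    have : (2 * S + k * D * D + D * E * k : ℚ) = k * (2 * D * (n + D + 1) + D) + D * E * k * k := by
      exact_mod_cast h2
    linarith
  have hs : (s : ℚ) = (2 * (D * (n + E + 1)) + D - D * D) / 2 := by
    have : (2 * s + D * D : ℚ) = 2 * (D * (n + E + 1)) + D := by exact_mod_cast h3
    linarith
  have ht : (t : ℚ) = (2 * (D * (b + 1)) + D - D * D) / 2 := by
    have : (2 * t + D * D : ℚ) = 2 * (D * (b + 1)) + D := by exact_mod_cast h4
    linarith
  have : (0 : ℚ) < s * t + S - (b + 1) * (s * D + k * D) := by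
    rw [hS, hs, ht, hb, hk, hn, hD]
    push_cast
    ring_nf
    positivity
  have h5 : ((b + 1) * (s * D + k * D) : ℚ) < s * t + S := by linarith
  exact_mod_cast h5

variable {K : Type*} [Field K] {G : K[X][X]}

/-- The bound on the degree in the first point of the auxiliary function. -/
def auxDeg (D : ℕ) : ℕ := D ^ 3 + 4 * D ^ 2 + 6 * D

lemma exists_auxiliary [IsDomain (CoordRing K G)] (hG : Good G) (hd : dd G ≠ 0)
    (hD : 0 < G.natDegree) :
    ∃ N ≠ 0, N ∈ jj G ^ (G.natDegree ^ 2) ∧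
      N ∈ bi G (auxDeg G.natDegree) (G.natDegree ^ 2 - 1) := by
  obtain ⟨E, hE⟩ := Nat.exists_eq_add_of_lt hD
  rw [zero_add] at hE
  set D := G.natDegree with hD'
  set n := E ^ 3 + 6 * E ^ 2 + 14 * E + 10 with hn
  set k := D ^ 2 with hk
  set b := E * k + D with hb
  have hE' : D - 1 = E := by omega
  have hk0 : 0 < k := by positivity
  have h1 := le_finrank_nn hG hd (n := n) (b := b) (k := k) (by omega) (by
    rw [← hD', hE']; omega)
  rw [← hD', hE'] at h1
  have h2 := card_exps_lt hE hn hk hb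
  have h3 := finrank_inf_bi_le hG hd (n + E) k (k - 1) (b + 1)
  rw [← hD', show k - 1 + (b + 1) = b + k by omega] at h3
  rw [nn] at h1
  have h4 : 0 < Module.finrank K ((jj G ^ k).restrictScalars K ⊓ bi G (n + E + k) (k - 1) :
      Submodule K (Sq G)) := by
    omega
  have := finiteDimensional_bi hG (n + E + k) (k - 1)
  have h5 : ((jj G ^ k).restrictScalars K ⊓ bi G (n + E + k) (k - 1) : Submodule K (Sq G)) ≠ ⊥ := by
    intro h
    rw [h, finrank_bot] at h4
    exact lt_irrefl _ h4
  obtain ⟨N, hN, hN0⟩ := Submodule.exists_mem_ne_zero_of_ne_bot h5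
  refine ⟨N, hN0, hN.1, fil_mono le_rfl ?_ hN.2⟩
  rw [auxDeg, hn, hk, hE]
  ring_nf
  omega

end

section

section Independence

variable {K : Type*} [Field K] {G : K[X][X]}

lemma evalAt_coord_eq {S : Type*} [CommRing S] [Algebra K S] (p : K[X][X]) :
    evalAt (xc S G) (yc S G) p = AdjoinRoot.mk (ext S G) (ext S p) := by
  have h : evalAt (xc S G) (yc S G) = (AdjoinRoot.mk (ext S G)).comp
      (mapRingHom (mapRingHom (algebraMap K S))) := by
    ext a
    · simp [algebraMap_coordRing, sc]
    · simp [xc]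
    · simp [yc]
  rw [h, RingHom.comp_apply, coe_mapRingHom]

/-- Differentiation in the first variable. -/
noncomputable def derivX : Derivation K K[X][X] K[X][X] :=
  PolynomialModule.equivPolynomialSelf.compDer (derivative' (R := K)).mapCoeffs

lemma coeff_derivX (p : K[X][X]) (i : ℕ) : (derivX p).coeff i = derivative (p.coeff i) := rfl

lemma derivX_C (p : K[X]) : derivX (C p) = C (derivative p) := by
  ext1 i
  rw [coeff_derivX, coeff_C, coeff_C]
  split_ifs <;> simp

lemma ext_self (p : K[X][X]) : ext K p = p := by
  rw [ext, Algebra.algebraMap_self, mapRingHom_id, map_id]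

lemma eq_zero_of_sq_add_mul_sq [CharP K 2] [IsDomain (CoordRing K G)] (hd : dd G ≠ 0)
    {u v : CoordRing K G} (h : u ^ 2 + xc K G * v ^ 2 = 0) : u = 0 ∧ v = 0 := by
  obtain ⟨U, rfl⟩ := AdjoinRoot.mk_surjective u
  obtain ⟨V, rfl⟩ := AdjoinRoot.mk_surjective v
  have h1 : ext K G ∣ U ^ 2 + C X * V ^ 2 := by
    rw [← AdjoinRoot.mk_eq_zero, ← h]
    simp [xc]
  obtain ⟨H, hH⟩ := h1
  have h2 : ((2 : ℕ) : K[X][X]) = 0 := CharP.cast_eq_zero _ 2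
  have hdx : V ^ 2 = derivX (ext K G) * H + ext K G * derivX H := by
    have := congrArg derivX hH
    rw [map_add, Derivation.leibniz, Derivation.leibniz, Derivation.leibniz_pow,
      Derivation.leibniz_pow, derivX_C, derivative_X] at this
    simp only [← Nat.cast_smul_eq_nsmul K[X][X], h2, smul_eq_mul, C_1, mul_one] at this
    linear_combination this
  have hdy : 0 = derivative (ext K G) * H + ext K G * derivative H := by
    have := congrArg derivative hH
    rw [derivative_add, derivative_mul, derivative_mul, derivative_pow, derivative_pow,
      derivative_C] at this
    have h2' : (C ((2 : ℕ) : K[X]) : K[X][X]) = 0 := by rw [CharP.cast_eq_zero, C_0]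
    simp only [h2'] at this
    linear_combination this
  have hm : AdjoinRoot.mk (ext K G) (ext K G) = 0 := AdjoinRoot.mk_self
  have h3 : dd G * AdjoinRoot.mk (ext K G) V ^ 2 = 0 := by
    have hG' : ext K (derivative G) = derivative (ext K G) := (derivative_map ..).symm
    rw [dd, evalAt_coord_eq, hG', ← map_pow, hdx]
    have h4 := congrArg (AdjoinRoot.mk (ext K G)) hdy
    simp only [map_add, map_mul, map_zero, hm, zero_mul, add_zero] at h4 ⊢
    rw [mul_left_comm, ← h4, mul_zero]
  have h5 : AdjoinRoot.mk (ext K G) V = 0 :=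
    pow_eq_zero_iff two_ne_zero |>.1 ((mul_eq_zero.1 h3).resolve_left hd)
  refine ⟨?_, h5⟩
  rw [h5, zero_pow two_ne_zero, mul_zero, add_zero] at h
  exact pow_eq_zero_iff two_ne_zero |>.1 h

lemma sum_range_two_mul {M : Type*} [AddCommMonoid M] (f : ℕ → M) (n : ℕ) :
    ∑ i ∈ Finset.range (2 * n), f i =
      ∑ i ∈ Finset.range n, f (2 * i) + ∑ i ∈ Finset.range n, f (2 * i + 1) := by
  induction n with
  | zero => simp
  | succ n ih =>
    rw [Nat.mul_succ, Finset.sum_range_succ, Finset.sum_range_succ, ih, Finset.sum_range_succ,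
      Finset.sum_range_succ]
    abel

lemma eq_zero_of_sum_pow_mul_eq_zero [CharP K 2] [IsDomain (CoordRing K G)] (hd : dd G ≠ 0)
    {M : ℕ} {c : ℕ → CoordRing K G}
    (h : ∑ i ∈ Finset.range (2 ^ M), c i ^ 2 ^ M * xc K G ^ i = 0) :
    ∀ i < 2 ^ M, c i = 0 := by
  have : CharP (CoordRing K G) 2 := charP_of_injective_algebraMap' K 2
  induction M generalizing c with
  | zero => simpa using h
  | succ M ih =>
    rw [pow_succ', sum_range_two_mul] at h
    have h1 : (∑ i ∈ Finset.range (2 ^ M), c (2 * i) ^ 2 ^ M * xc K G ^ i) ^ 2 + xc K G *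
        (∑ i ∈ Finset.range (2 ^ M), c (2 * i + 1) ^ 2 ^ M * xc K G ^ i) ^ 2 = 0 := by
      rw [← h, sum_pow_char, sum_pow_char, Finset.mul_sum]
      congr 1 <;> exact Finset.sum_congr rfl fun i _ => by ring
    obtain ⟨he, ho⟩ := eq_zero_of_sq_add_mul_sq hd h1
    intro i hi
    rw [pow_succ'] at hi
    obtain ⟨j, rfl | rfl⟩ := Nat.even_or_odd' i
    · exact ih he j (by omega)
    · exact ih ho j (by omega)

end Independence

section Norm

variable {K S : Type*} [Field K] [CommRing S] [Algebra K S] {G : K[X][X]}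

lemma dvd_algebraMap_norm {R B : Type*} [CommRing R] [CommRing B] [Algebra R B]
    [Module.Free R B] [Module.Finite R B] (N : B) :
    N ∣ algebraMap R B (Algebra.norm R N) := by
  have h := LinearMap.aeval_self_charpoly (LinearMap.mulLeft R N)
  have h1 := LinearMap.congr_fun h 1
  have h2 : aeval N (LinearMap.mulLeft R N).charpoly = 0 := by
    have h3 := aeval_algHom_apply (Algebra.lmul R B) N (LinearMap.mulLeft R N).charpoly
    have h4 := LinearMap.congr_fun h3 1
    simpa using h4.symm.trans h1
  rw [← divX_mul_X_add (LinearMap.mulLeft R N).charpoly] at h2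
  simp only [map_add, map_mul, aeval_X, aeval_C] at h2
  rw [Algebra.norm_apply]
  change N ∣ algebraMap R B (LinearMap.det (LinearMap.mulLeft R N))
  rw [LinearMap.det_eq_sign_charpoly_coeff, map_mul]
  refine Dvd.dvd.mul_left ?_ _
  rw [← dvd_neg]
  exact ⟨aeval N (LinearMap.mulLeft R N).charpoly.divX, by linear_combination -h2⟩

lemma powerBasis_repr [Nontrivial S] (hG : Good G) (N : CoordRing S G)
    (i : Fin (AdjoinRoot.powerBasis' (hG.ext_monic (S := S))).dim) :
    (AdjoinRoot.powerBasis' (hG.ext_monic (S := S))).basis.repr N i = (rep hG N).coeff i := rfl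

lemma natDegree_norm_le [IsDomain S] (hG : Good G) {N : CoordRing S G} {α : ℕ}
    (hN : N ∈ fil G (⊤ : Submodule K S) α) :
    (Algebra.norm S[X] N).natDegree ≤ α * G.natDegree := by
  set B := (AdjoinRoot.powerBasis' (hG.ext_monic (S := S))) with hB
  have hdim : B.dim = G.natDegree := by
    rw [hB, AdjoinRoot.powerBasis'_dim, hG.natDegree_ext]
  have hentry : ∀ i j, Algebra.leftMulMatrix B.basis N i j ≠ 0 →
      (Algebra.leftMulMatrix B.basis N i j).natDegree + i ≤ α + j := by
    intro i j h
    have h1 : Algebra.leftMulMatrix B.basis N i j = (rep hG (N * yc S G ^ (j : ℕ))).coeff i := by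
      rw [Algebra.leftMulMatrix_eq_repr_mul, B.basis_eq_pow]
      exact powerBasis_repr hG _ i
    have h2 : N * yc S G ^ (j : ℕ) ∈ fil G (⊤ : Submodule K S) (α + j) := by
      refine mul_mem_fil le_top le_rfl hN (T' := ⊤) ?_
      have := monomial_mem_fil (G := G) (T := (⊤ : Submodule K S)) (t := 1) (i := 0) trivial
        (zero_add (j : ℕ)).le
      simpa using this
    rw [h1] at h ⊢
    by_contra hlt
    apply h
    rw [mem_fil_iff hG] at h2
    have h3 := (h2 ((rep hG (N * yc S G ^ (j : ℕ))).coeff i).natDegree i).2 (by omega)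
    exact leadingCoeff_eq_zero.1 h3
  rw [Algebra.norm_eq_matrix_det B.basis, Matrix.det_apply]
  refine natDegree_sum_le_of_forall_le _ _ fun σ _ => ?_
  refine (natDegree_smul_le _ _).trans ?_
  by_cases h0 : ∏ i, Algebra.leftMulMatrix B.basis N (σ i) i = 0
  · rw [h0, natDegree_zero]; exact Nat.zero_le _
  rw [← ne_eq, Finset.prod_ne_zero_iff] at h0
  refine (natDegree_prod_le _ _).trans ?_
  have h1 := Finset.sum_le_sum (s := Finset.univ) fun i hi => hentry (σ i) i (h0 i hi)
  rw [Finset.sum_add_distrib, Finset.sum_add_distrib, Equiv.sum_comp σ fun i => (i : ℕ)] at h1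
  simp only [Finset.sum_const, Finset.card_univ, Fintype.card_fin, smul_eq_mul, hdim] at h1
  rw [mul_comm α]
  exact Nat.le_of_add_le_add_right h1

end Norm

section Frobenius

variable {K : Type*} [Field K] [Fintype K] {G : K[X][X]}

variable (G) in
/-- Restriction to the graph of the Frobenius. -/
noncomputable def frob : Sq G →ₐ[K] CoordRing K G :=
  specHom (FiniteField.frobeniusAlgHom K (CoordRing K G)) (xc K G) (yc K G) evalAt_coord

@[simp] lemma frob_x₁ : frob G (x₁ G) = xc K G := spec_xc _ _ _ evalAt_coord
@[simp] lemma frob_y₁ : frob G (y₁ G) = yc K G := spec_yc _ _ _ evalAt_coord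
@[simp] lemma frob_sc (t : CoordRing K G) : frob G (sc G t) = t ^ Fintype.card K :=
  spec_sc _ _ _ evalAt_coord _

lemma frob_ne_zero [CharP K 2] [IsDomain (CoordRing K G)] [IsDomain (Sq G)] (hG : Good G)
    (hd : dd G ≠ 0) {M : ℕ} (hq : Fintype.card K = 2 ^ M) {α : ℕ}
    (hα : α * G.natDegree < 2 ^ M) {N : Sq G} (hN0 : N ≠ 0)
    (hN : N ∈ fil G (⊤ : Submodule K (CoordRing K G)) α) : frob G N ≠ 0 := by
  intro h
  set B := (AdjoinRoot.powerBasis' (hG.ext_monic (S := CoordRing K G))) with hB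
  have hfree : Module.Free (CoordRing K G)[X] (Sq G) := Module.Free.of_basis B.basis
  have hfin : Module.Finite (CoordRing K G)[X] (Sq G) := Module.Finite.of_basis B.basis
  set P := Algebra.norm (CoordRing K G)[X] N with hP
  have hP0 : P ≠ 0 := Algebra.norm_ne_zero_iff.2 hN0
  have hPd : P.natDegree < 2 ^ M := (natDegree_norm_le hG hN).trans_lt hα
  have h1 : frob G (algebraMap (CoordRing K G)[X] (Sq G) P) = 0 := by
    obtain ⟨Z, hZ⟩ := dvd_algebraMap_norm (R := (CoordRing K G)[X]) N
    rw [hP, hZ, map_mul, h, zero_mul]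
  have h2 : algebraMap (CoordRing K G)[X] (Sq G) P =
      ∑ i ∈ Finset.range (2 ^ M), sc G (P.coeff i) * x₁ G ^ i := by
    conv_lhs => rw [P.as_sum_range' _ hPd, map_sum]
    refine Finset.sum_congr rfl fun i _ => ?_
    rw [← C_mul_X_pow_eq_monomial, map_mul, map_pow]
    rfl
  rw [h2, map_sum] at h1
  simp only [map_mul, map_pow, frob_sc, frob_x₁, hq] at h1
  have h3 := eq_zero_of_sum_pow_mul_eq_zero hd h1
  exact hP0 (leadingCoeff_eq_zero.1 (h3 _ hPd))

end Frobenius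

end

section

section Vanishing

variable {K : Type*} [Field K] [Fintype K]

lemma natDegree_X_pow_card_sub_X : (X ^ Fintype.card K - X : K[X]).natDegree = Fintype.card K :=
  FiniteField.X_pow_card_sub_X_natDegree_eq K Fintype.one_lt_card

lemma monic_X_pow_card_sub_X (R : Type*) [Ring R] : (X ^ Fintype.card K - X : R[X]).Monic :=
  monic_X_pow_sub (degree_X_le.trans_lt (by exact_mod_cast Fintype.one_lt_card))

lemma eval_X_pow_card_sub_X (u : K) : eval u (X ^ Fintype.card K - X : K[X]) = 0 := by
  simp [FiniteField.pow_card]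

lemma natDegree_mod_lt {R : Type*} [CommRing R] [Nontrivial R] (p : R[X]) :
    (p %ₘ (X ^ Fintype.card K - X)).natDegree < Fintype.card K := by
  have h : (X ^ Fintype.card K - X : R[X]).natDegree = Fintype.card K := by
    rw [natDegree_sub_eq_left_of_natDegree_lt] <;> rw [natDegree_X_pow]
    rw [natDegree_X]
    exact Fintype.one_lt_card
  refine (natDegree_modByMonic_lt p (monic_X_pow_card_sub_X (K := K) R) ?_).trans_eq h
  intro h1
  rw [h1, natDegree_one] at h
  exact Fintype.card_ne_zero h.symm

lemma X_pow_card_sub_X_dvd {p : K[X]} (h : ∀ u, eval u p = 0) : X ^ Fintype.card K - X ∣ p := by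
  rw [← modByMonic_eq_zero_iff_dvd (monic_X_pow_card_sub_X (K := K) K)]
  refine eq_zero_of_natDegree_lt_card_of_eval_eq_zero _ Function.injective_id (fun u => ?_)
    (natDegree_mod_lt p)
  have := congrArg (eval u) (modByMonic_add_div p (X ^ Fintype.card K - X))
  rwa [eval_add, eval_mul, eval_X_pow_card_sub_X, zero_mul, add_zero, h] at this

lemma exists_of_vanishing {p : K[X][X]} (h : ∀ u v : K, evalAt u v p = 0) :
    ∃ a b : K[X][X], p = a * C (X ^ Fintype.card K - X) + b * (X ^ Fintype.card K - X) := by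
  set r := p %ₘ (X ^ Fintype.card K - X) with hr
  have hdiv := modByMonic_add_div p (X ^ Fintype.card K - X)
  have h1 : ∀ u v : K, evalAt u v r = 0 := by
    intro u v
    have := congrArg (evalAt u v) hdiv
    rw [map_add, map_mul, h, map_sub, map_pow, evalAt_X, FiniteField.pow_card, sub_self, zero_mul,
      add_zero] at this
    exact this
  have h2 : ∀ u, r.map (evalRingHom u) = 0 := by
    intro u
    refine eq_zero_of_natDegree_lt_card_of_eval_eq_zero _ Function.injective_id (fun v => ?_)
      ((natDegree_map_le).trans_lt (natDegree_mod_lt p))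
    rw [← h1 u v, evalAt, eval_map, coe_eval₂RingHom]
    congr 1
  have h3 : C (X ^ Fintype.card K - X) ∣ r := by
    rw [C_dvd_iff_dvd_coeff]
    refine fun j => X_pow_card_sub_X_dvd fun u => ?_
    have := congrArg (fun s => coeff s j) (h2 u)
    simpa using this
  obtain ⟨a, ha⟩ := h3
  refine ⟨a, p /ₘ (X ^ Fintype.card K - X), ?_⟩
  conv_lhs => rw [← hdiv]
  rw [← hr, ha]
  ring

variable {G : K[X][X]}

lemma mk_mem_span_of_vanishing {p : K[X][X]}
    (h : ∀ u v : K, evalAt u v G = 0 → evalAt u v p = 0) :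
    evalAt (xc K G) (yc K G) p ∈ Ideal.span {xc K G - xc K G ^ Fintype.card K,
      yc K G - yc K G ^ Fintype.card K} := by
  obtain ⟨a, b, hab⟩ := exists_of_vanishing (p := p - p * G ^ (Fintype.card K - 1)) (by
    intro u v
    rw [map_sub, map_mul, map_pow]
    by_cases h0 : evalAt u v G = 0
    · rw [h u v h0, zero_mul, sub_self]
    · rw [FiniteField.pow_card_sub_one_eq_one _ h0, mul_one, sub_self])
  have h1 := congrArg (evalAt (xc K G) (yc K G)) hab
  have hq : Fintype.card K - 1 ≠ 0 := Nat.sub_ne_zero_of_lt Fintype.one_lt_card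
  rw [map_sub, map_mul, map_pow, evalAt_coord, zero_pow hq, mul_zero, sub_zero] at h1
  rw [h1, map_add, map_mul, map_mul, evalAt_C, map_sub, map_sub, map_pow, map_pow, aeval_X,
    evalAt_X, Ideal.mem_span_pair]
  exact ⟨-evalAt (xc K G) (yc K G) a, -evalAt (xc K G) (yc K G) b, by ring⟩

end Vanishing

variable {K : Type*} [Field K] [Fintype K] {G : K[X][X]}

lemma frob_mem_flt [Nontrivial (CoordRing K G)] (hG : Good G) {m r : ℕ} {N : Sq G}
    (hN : N ∈ bi G m r) : frob G N ∈ flt G (r * Fintype.card K + m) := by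
  refine fil_induction hG (P := fun N => frob G N ∈ flt G (r * Fintype.card K + m)) hN
    (by simp) (fun a b ha hb => by rw [map_add]; exact Submodule.add_mem _ ha hb) ?_
  intro i j t ht hij _
  have h1 : frob G (xc (CoordRing K G) G) = xc K G := frob_x₁
  have h2 : frob G (yc (CoordRing K G) G) = yc K G := frob_y₁
  rw [map_mul, map_mul, map_pow, map_pow, frob_sc, h1, h2, mul_assoc]
  exact mul_mem_flt le_rfl (pow_mem_flt ht _) (xy_mem_flt hij)

lemma mul_map_jj_le {e : CoordRing K G} (he : e ∈ Ideal.span {xc K G - xc K G ^ Fintype.card K,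
      yc K G - yc K G ^ Fintype.card K}) :
    Ideal.span {e} * (jj G).map (frob G) ≤ Ideal.span {xc K G - xc K G ^ Fintype.card K} := by
  rw [jj, Ideal.map_span, Ideal.span_mul_span', Ideal.span_le]
  rintro _ ⟨e', he', w, hw, rfl⟩
  rw [Set.mem_singleton_iff] at he'
  subst he'
  simp only [SetLike.mem_coe, Ideal.mem_span_singleton]
  rw [Set.image_pair, map_sub, frob_x₁, frob_sc, vv, map_divDiff, frob_x₁, frob_y₁, frob_sc] at hw
  rcases hw with rfl | rfl
  · obtain ⟨a, b, rfl⟩ := Ideal.mem_span_pair.1 he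
    have hq : evalAt (xc K G ^ Fintype.card K) (yc K G ^ Fintype.card K) G = 0 := by
      have := map_evalAt (FiniteField.frobeniusAlgHom K (CoordRing K G)) (xc K G) (yc K G) G
      rw [evalAt_coord, map_zero] at this
      exact this.symm
    have h := sub_dvd_divDiff_mul (evalAt_coord (S := K) (G := G)) hq
    rw [add_mul]
    refine dvd_add ((dvd_mul_left _ _).mul_right _) ?_
    rw [mul_assoc, mul_comm (yc K G - _)]
    exact h.mul_left b
  · exact dvd_mul_left _ _

lemma eq_zero_of_pow_mul_mem_flt (hG : Good G) {k m : ℕ} (hm : m < k * Fintype.card K)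
    {h : CoordRing K G} (hh : (xc K G - xc K G ^ Fintype.card K) ^ k * h ∈ flt G m) : h = 0 := by
  set p : K[X] := (X - X ^ Fintype.card K) ^ k with hp
  have hpm : p.natDegree = k * Fintype.card K := by
    rw [hp, natDegree_pow, ← natDegree_neg, neg_sub, natDegree_X_pow_card_sub_X]
  have hpm0 : p ≠ 0 := by
    rintro h0
    rw [h0, natDegree_zero] at hpm
    omega
  have h1 : (xc K G - xc K G ^ Fintype.card K) ^ k = AdjoinRoot.mk (ext K G) (C p) := by
    simp [hp, xc]
  rw [h1, flt, mem_fil_iff hG, rep_mk_C_mul] at hh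
  apply rep_injective hG
  ext1 j
  rw [map_zero, coeff_zero]
  by_contra h0
  have h2 := (hh (p * (rep hG h).coeff j).natDegree j).2 (by
    rw [natDegree_mul hpm0 h0]
    omega)
  rw [coeff_C_mul] at h2
  exact mul_ne_zero hpm0 h0 (leadingCoeff_eq_zero.1 h2)

lemma eq_zero_of_mem_span [CharP K 2] [IsDomain (CoordRing K G)] [IsDomain (Sq G)] (hG : Good G)
    (hd : dd G ≠ 0) (hD : 0 < G.natDegree) {M : ℕ} (hM : Fintype.card K = 2 ^ M)
    (hq : (G.natDegree + 1) ^ 4 ≤ Fintype.card K) {e : CoordRing K G} (he2 : e ∈ flt G 2)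
    (he : e ∈ Ideal.span {xc K G - xc K G ^ Fintype.card K,
      yc K G - yc K G ^ Fintype.card K}) : e = 0 := by
  obtain ⟨N, hN0, hNJ, hN⟩ := exists_auxiliary hG hd hD
  set D := G.natDegree with hD'
  have hα : auxDeg D * D < 2 ^ M := by
    rw [← hM]
    refine lt_of_lt_of_le ?_ hq
    rw [auxDeg]
    ring_nf
    omega
  have h1 := frob_ne_zero hG hd hM hα hN0 (fil_mono le_top le_rfl hN)
  have h2 : e ^ (D ^ 2) * frob G N ∈
      Ideal.span {(xc K G - xc K G ^ Fintype.card K) ^ (D ^ 2)} := by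
    rw [← Ideal.span_singleton_pow]
    refine Ideal.pow_right_mono (mul_map_jj_le he) _ ?_
    rw [mul_pow, ← Ideal.map_pow]
    exact Ideal.mul_mem_mul (Ideal.pow_mem_pow (Ideal.mem_span_singleton_self _) _)
      (Ideal.mem_map_of_mem _ hNJ)
  obtain ⟨h, hh⟩ := Ideal.mem_span_singleton.1 h2
  have h3 := mul_mem_flt le_rfl (pow_mem_flt he2 (D ^ 2)) (frob_mem_flt hG hN)
  rw [hh] at h3
  have h4 := eq_zero_of_pow_mul_mem_flt hG (by
    have h5 : 0 < D ^ 2 := by positivity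
    obtain ⟨c, hc⟩ := Nat.exists_eq_add_of_lt h5
    rw [zero_add] at hc
    have h6 : 2 * D ^ 2 + auxDeg D < Fintype.card K := by
      refine lt_of_lt_of_le ?_ hq
      rw [auxDeg]
      obtain ⟨E, hE⟩ := Nat.exists_eq_add_of_lt hD
      rw [hE]
      ring_nf
      nlinarith
    rw [hc] at h6 ⊢
    rw [Nat.add_sub_cancel, add_mul c, one_mul]
    omega) h3
  rw [h4, mul_zero] at hh
  exact pow_eq_zero_iff (by positivity) |>.1 ((mul_eq_zero.1 hh).resolve_right h1)

end

section

section BaseChange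

variable {K S R : Type*} [Field K] [CommRing S] [Algebra K S] [CommRing R] [Algebra K R]
  {G : K[X][X]}

variable (G) in
/-- Base change of coordinate rings. -/
noncomputable def baseChange (φ : S →ₐ[K] R) : CoordRing S G →ₐ[K] CoordRing R G :=
  specHom ((scHom G).comp φ) (xc R G) (yc R G) evalAt_coord

lemma baseChange_mk (φ : S →ₐ[K] R) (p : S[X][X]) :
    baseChange G φ (AdjoinRoot.mk (ext S G) p) =
      AdjoinRoot.mk (ext R G) (p.map (mapRingHom φ.toRingHom)) := by
  have h : ((baseChange G φ : CoordRing S G →+* CoordRing R G).comp (AdjoinRoot.mk (ext S G))) =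
      (AdjoinRoot.mk (ext R G)).comp (mapRingHom (mapRingHom φ.toRingHom)) := by
    ext a
    · simp only [RingHom.comp_apply, coe_mapRingHom, map_C]
      exact (spec_sc _ _ _ evalAt_coord a)
    · simp only [RingHom.comp_apply, coe_mapRingHom, map_C, map_X]
      exact (spec_xc _ _ _ evalAt_coord)
    · simp only [RingHom.comp_apply, coe_mapRingHom, map_X]
      exact (spec_yc _ _ _ evalAt_coord)
  exact RingHom.congr_fun h p

lemma rep_baseChange (hG : Good G) (φ : S →ₐ[K] R) (N : CoordRing S G) :
    rep hG (baseChange G φ N) = (rep hG N).map (mapRingHom φ.toRingHom) := by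
  obtain ⟨p, rfl⟩ := AdjoinRoot.mk_surjective N
  have h : (ext S G).map (mapRingHom φ.toRingHom) = ext R G := by
    rw [ext, ext, map_map, mapRingHom_comp]
    congr 2
    ext a
    simp
  rw [baseChange_mk, rep_mk, rep_mk, map_modByMonic _ hG.ext_monic, h]

lemma baseChange_ne_zero (hG : Good G) (φ : S →ₐ[K] R) {N : CoordRing S G} {i j : ℕ}
    (h : φ (((rep hG N).coeff j).coeff i) ≠ 0) : baseChange G φ N ≠ 0 := by
  intro h0
  apply h
  have := congrArg (fun p : R[X][X] => (p.coeff j).coeff i) (rep_baseChange hG φ N)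
  simpa [h0] using this.symm

lemma exists_coeff_ne_zero (hG : Good G) {N : CoordRing S G} (h : N ≠ 0) :
    ∃ i j, ((rep hG N).coeff j).coeff i ≠ 0 := by
  by_contra! h0
  apply h
  apply rep_injective hG
  ext j i
  simpa using h0 i j

lemma isDomain_of_separating [IsDomain S] (hG : Good G) [IsDomain (CoordRing R G)]
    (hs : ∀ f : S, f ≠ 0 → ∃ φ : S →ₐ[K] R, φ f ≠ 0) : IsDomain (CoordRing S G) := by
  obtain ⟨φ, _⟩ := hs 1 one_ne_zero
  have : Nontrivial (CoordRing S G) := (baseChange G φ).toRingHom.domain_nontrivial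
  have : NoZeroDivisors (CoordRing S G) := by
    refine ⟨fun {N N'} h => ?_⟩
    by_contra! h0
    obtain ⟨i, j, hij⟩ := exists_coeff_ne_zero hG h0.1
    obtain ⟨i', j', hij'⟩ := exists_coeff_ne_zero hG h0.2
    obtain ⟨φ, hφ⟩ := hs _ (mul_ne_zero hij hij')
    rw [map_mul] at hφ
    refine mul_ne_zero (baseChange_ne_zero hG φ (left_ne_zero_of_mul hφ))
      (baseChange_ne_zero hG φ (right_ne_zero_of_mul hφ)) ?_
    rw [← map_mul, h, map_zero]
  exact NoZeroDivisors.to_isDomain _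

end BaseChange

variable {K L : Type*} [Field K] [Field L] [Algebra K L] {G : K[X][X]}

lemma isDomain_coordRing_of_irreducible (h : Irreducible (ext L G)) : IsDomain (CoordRing L G) :=
  AdjoinRoot.isDomain_of_prime h.prime

lemma dd_ne_zero (hG : Good G) (h : derivative G ≠ 0) : dd G ≠ 0 := by
  rw [dd, evalAt_coord_eq]
  refine AdjoinRoot.mk_ne_zero_of_degree_lt hG.ext_monic ?_ ?_
  · rwa [ext_self]
  · rw [ext_self, ext_self]
    exact degree_derivative_lt hG.monic.ne_zero

variable [IsAlgClosed L]

lemma exists_point (hG : Good G) (hD : 0 < G.natDegree) (u : L) : ∃ v : L, evalAt u v G = 0 := by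
  have h : (G.map (aeval u).toRingHom).degree ≠ 0 := by
    rw [hG.monic.degree_map, degree_eq_natDegree hG.monic.ne_zero]
    exact_mod_cast hD.ne'
  obtain ⟨v, hv⟩ := IsAlgClosed.exists_root _ h
  exact ⟨v, by rwa [IsRoot, eval_map] at hv⟩

lemma exists_algHom_ne_zero [IsDomain (CoordRing K G)] (hG : Good G) (hD : 0 < G.natDegree)
    {f : CoordRing K G} (hf : f ≠ 0) : ∃ φ : CoordRing K G →ₐ[K] L, φ f ≠ 0 := by
  set B := AdjoinRoot.powerBasis' (hG.ext_monic (S := K))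
  have : Module.Free K[X] (CoordRing K G) := Module.Free.of_basis B.basis
  have : Module.Finite K[X] (CoordRing K G) := Module.Finite.of_basis B.basis
  obtain ⟨Z, hZ⟩ := dvd_algebraMap_norm (R := K[X]) f
  have hP : (Algebra.norm K[X] f).map (algebraMap K L) ≠ 0 := by
    rw [Polynomial.map_ne_zero_iff (algebraMap K L).injective]
    exact Algebra.norm_ne_zero_iff.2 hf
  have : Infinite L := IsAlgClosed.instInfinite
  obtain ⟨u, hu⟩ : ∃ u, eval u ((Algebra.norm K[X] f).map (algebraMap K L)) ≠ 0 := by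
    by_contra! h
    exact hP (Polynomial.funext fun u => by rw [h, eval_zero])
  obtain ⟨v, hv⟩ := exists_point hG hD u
  refine ⟨specHom (Algebra.ofId K L) u v hv, fun h0 => hu ?_⟩
  have h1 := congrArg (specHom (Algebra.ofId K L) u v hv) hZ
  rw [map_mul, h0, zero_mul] at h1
  rw [← h1, eval_map]
  change _ = spec (Algebra.ofId K L) u v hv (AdjoinRoot.mk (ext K G) (C _))
  rw [spec, AdjoinRoot.lift_mk, eval₂_C]
  rfl

variable (L) in
theorem dvd_of_vanishing [Fintype K] [CharP K 2] (hG : Good G) (hirr : Irreducible (ext L G))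
    (hder : derivative G ≠ 0) {M : ℕ} (hM : Fintype.card K = 2 ^ M)
    (hq : (G.natDegree + 1) ^ 4 ≤ Fintype.card K) {p : K[X][X]}
    (hp : p ∈ boxed (⊤ : Submodule K K) 2)
    (h : ∀ u v : K, evalAt u v G = 0 → evalAt u v p = 0) : G ∣ p := by
  have hD : 0 < G.natDegree := by
    by_contra h0
    apply hder
    rw [eq_C_of_natDegree_eq_zero (p := G) (by omega), derivative_C]
  have h1 := isDomain_coordRing_of_irreducible hirr
  have h2 : IsDomain (CoordRing K G) := isDomain_of_separating (R := L) hG fun f hf =>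
    ⟨Algebra.ofId K L, by simpa [Algebra.ofId_apply] using hf⟩
  have h3 : IsDomain (Sq G) := isDomain_of_separating (R := L) hG fun f hf =>
    exists_algHom_ne_zero hG hD hf
  have h4 := eq_zero_of_mem_span hG (dd_ne_zero hG hder) hD hM hq (e := evalAt (xc K G) (yc K G) p)
    (by rw [evalAt_coord_eq, ext_self p]; exact mk_mem_fil hp) (mk_mem_span_of_vanishing h)
  rwa [evalAt_coord_eq, AdjoinRoot.mk_eq_zero, ext_self, ext_self] at h4

end

section

section Shear

variable {R : Type*} [CommRing R]

/-- The linear change of variables `(x, y) ↦ (x + c y, y)`, from `MvPolynomial (Fin 2) R` to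
`R[X][X]`. -/
noncomputable def shear (c : R) : MvPolynomial (Fin 2) R ≃ₐ[R] R[X][X] :=
  .ofAlgHom (MvPolynomial.aeval ![C X + C (C c) * X, X])
    (aevalAeval (MvPolynomial.X 0 - MvPolynomial.C c * MvPolynomial.X 1) (MvPolynomial.X 1))
    (by ext <;> simp) (by ext i; fin_cases i <;> simp)

@[simp] lemma shear_C (c a : R) : shear c (MvPolynomial.C a) = C (C a) := by
  simp [shear]

@[simp] lemma shear_X_zero (c : R) : shear c (MvPolynomial.X 0) = C X + C (C c) * X := by
  simp [shear]

@[simp] lemma shear_X_one (c : R) : shear c (MvPolynomial.X 1) = X := by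
  simp [shear]

lemma derivative_shear (c : R) (P : MvPolynomial (Fin 2) R) :
    derivative (shear c P) = shear c (c • pderiv 0 P + pderiv 1 P) := by
  induction P using MvPolynomial.induction_on with
  | C a => simp
  | add p q hp hq => simp only [map_add, hp, hq, smul_add]; ring
  | mul_X p i hp =>
    rw [map_mul, derivative_mul, hp]
    simp only [MvPolynomial.smul_eq_C_mul, map_add, map_mul, shear_C, Derivation.leibniz,
      smul_eq_mul]
    fin_cases i
    · simp [pderiv_X]
      ring
    · simp [pderiv_X]
      ring

end Shear

variable {K L : Type*} [Field K] [Field L] [Algebra K L]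

lemma ext_shear (c : K) (P : MvPolynomial (Fin 2) K) :
    ext L (shear c P) = shear (algebraMap K L c) (MvPolynomial.map (algebraMap K L) P) := by
  induction P using MvPolynomial.induction_on with
  | C a => simp [ext]
  | add p q hp hq => simp only [ext, map_add, Polynomial.map_add] at *; rw [hp, hq]
  | mul_X p i hp =>
    simp only [ext, map_mul, Polynomial.map_mul] at *
    rw [hp]
    fin_cases i <;> simp

lemma evalAt_shear (c u v : K) (P : MvPolynomial (Fin 2) K) :
    evalAt u v (shear c P) = MvPolynomial.eval ![u + c * v, v] P := by
  induction P using MvPolynomial.induction_on with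
  | C a => simp
  | add p q hp hq => simp only [map_add]; rw [hp, hq]
  | mul_X p i hp =>
    simp only [map_mul]
    rw [hp]
    fin_cases i <;> simp

lemma one_mem_boxed_top : (1 : K[X][X]) ∈ boxed (⊤ : Submodule K K) 0 :=
  monomial_mem_boxed (i := 0) (j := 0) (t := (1 : K)) trivial le_rfl

lemma X_mem_boxed_top : (X : K[X][X]) ∈ boxed (⊤ : Submodule K K) 1 :=
  monomial_mem_boxed (i := 0) (j := 1) (t := (1 : K)) trivial le_rfl

lemma linear_mem_boxed_top (c : K) :
    (C X + C (C c) * X : K[X][X]) ∈ boxed (⊤ : Submodule K K) 1 := by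
  refine Submodule.add_mem _
    (monomial_mem_boxed (i := 1) (j := 0) (t := (1 : K)) trivial le_rfl) ?_
  have := monomial_mem_boxed (T := (⊤ : Submodule K K)) (i := 0) (j := 1) (m := 1) (t := c)
    trivial le_rfl
  rwa [← C_mul_X_eq_monomial] at this

lemma mul_mem_boxed_top {m m' : ℕ} {p p' : K[X][X]} (hp : p ∈ boxed (⊤ : Submodule K K) m)
    (hp' : p' ∈ boxed (⊤ : Submodule K K) m') : p * p' ∈ boxed (⊤ : Submodule K K) (m + m') :=
  boxed_mono le_top le_rfl (mul_mem_boxed hp hp')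

lemma pow_mem_boxed_top {m : ℕ} {p : K[X][X]} (hp : p ∈ boxed (⊤ : Submodule K K) m) (k : ℕ) :
    p ^ k ∈ boxed (⊤ : Submodule K K) (k * m) := by
  induction k with
  | zero => simpa using one_mem_boxed_top
  | succ k ih =>
    rw [pow_succ, add_mul, one_mul]
    exact mul_mem_boxed_top ih hp

lemma shear_monomial (c a : K) (s : Fin 2 →₀ ℕ) :
    shear c (MvPolynomial.monomial s a) = C (C a) * ((C X + C (C c) * X) ^ s 0 * X ^ s 1) := by
  rw [MvPolynomial.monomial_eq, Finsupp.prod_fintype _ _ (by simp)]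
  simp [Fin.prod_univ_two]

lemma shear_eq_sum (c : K) (P : MvPolynomial (Fin 2) K) :
    shear c P = ∑ s ∈ P.support,
      C (C (P.coeff s)) * ((C X + C (C c) * X) ^ s 0 * X ^ s 1) := by
  conv_lhs => rw [P.as_sum, map_sum]
  simp only [shear_monomial]

lemma shear_mem_boxed (c : K) (P : MvPolynomial (Fin 2) K) :
    shear c P ∈ boxed (⊤ : Submodule K K) P.totalDegree := by
  rw [shear_eq_sum]
  refine Submodule.sum_mem _ fun s hs => ?_
  have h := MvPolynomial.le_totalDegree hs
  rw [Finsupp.sum_fintype _ _ (by simp), Fin.sum_univ_two] at h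
  have h1 : (C (C (MvPolynomial.coeff s P)) : K[X][X]) ∈ boxed (⊤ : Submodule K K) 0 :=
    monomial_mem_boxed (i := 0) (j := 0) trivial le_rfl
  exact boxed_mono le_rfl (by omega) (mul_mem_boxed_top h1
    (mul_mem_boxed_top (pow_mem_boxed_top (linear_mem_boxed_top c) _)
      (pow_mem_boxed_top X_mem_boxed_top _)))

/-- The leading form of `P`, evaluated at `(X, 1)`. -/
noncomputable def topForm (P : MvPolynomial (Fin 2) K) : K[X] :=
  ∑ s ∈ P.support with s 0 + s 1 = P.totalDegree, monomial (s 0) (P.coeff s)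

lemma topForm_ne_zero {P : MvPolynomial (Fin 2) K} (hP : P ≠ 0) : topForm P ≠ 0 := by
  obtain ⟨s, hs, hsd⟩ := Finset.exists_mem_eq_sup P.support
    (MvPolynomial.support_nonempty.2 hP) fun s => s.sum fun _ e => e
  have hd : s 0 + s 1 = P.totalDegree := by
    rw [MvPolynomial.totalDegree, hsd, Finsupp.sum_fintype _ _ (by simp), Fin.sum_univ_two]
  intro h
  have h1 := congrArg (fun p : K[X] => p.coeff (s 0)) h
  simp only [topForm, finsetSum_coeff, coeff_monomial, coeff_zero] at h1
  rw [Finset.sum_eq_single s] at h1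
  · rw [if_pos rfl] at h1
    exact MvPolynomial.mem_support_iff.1 hs h1
  · intro t ht hts
    rw [Finset.mem_filter] at ht
    rw [if_neg]
    intro h0
    apply hts
    ext i
    fin_cases i
    · exact h0
    · have := ht.2
      simp only [Fin.mk_one]
      omega
  · intro h0
    exact absurd (Finset.mem_filter.2 ⟨hs, hd⟩) h0

lemma natDegree_topForm_le (P : MvPolynomial (Fin 2) K) :
    (topForm P).natDegree ≤ P.totalDegree := by
  refine natDegree_sum_le_of_forall_le _ _ fun s hs => (natDegree_monomial_le _).trans ?_
  have := (Finset.mem_filter.1 hs).2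
  omega

lemma coeff_shear_totalDegree (c : K) (P : MvPolynomial (Fin 2) K) :
    (shear c P).coeff P.totalDegree = C ((topForm P).eval c) := by
  have h : ((shear c P).coeff P.totalDegree).coeff 0 = (topForm P).eval c := by
    have h0 : ((shear c P).coeff P.totalDegree).coeff 0 =
        ((shear c P).map (evalRingHom 0)).coeff P.totalDegree := by
      rw [coeff_map, coe_evalRingHom, coeff_zero_eq_eval_zero]
    rw [h0, shear_eq_sum, Polynomial.map_sum, finsetSum_coeff, topForm,
      eval_finsetSum, Finset.sum_filter]
    refine Finset.sum_congr rfl fun s _ => ?_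
    simp only [Polynomial.map_mul, Polynomial.map_pow, Polynomial.map_add, map_C, map_X,
      coe_evalRingHom, eval_X, eval_C, map_zero, zero_add, mul_pow, eval_monomial]
    rw [mul_assoc, ← pow_add, coeff_C_mul, ← C_pow, coeff_C_mul, coeff_X_pow]
    simp only [eq_comm (a := P.totalDegree)]
    split_ifs <;> simp
  rw [← h]
  ext i
  rcases i with _ | i
  · simp
  · rw [coeff_C_succ]
    exact (shear_mem_boxed c P _ _).2 (by omega)

lemma natDegree_le_of_mem_boxed {m : ℕ} {p : K[X][X]} (hp : p ∈ boxed (⊤ : Submodule K K) m) :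
    p.natDegree ≤ m := by
  rw [natDegree_le_iff_coeff_eq_zero]
  intro j hj
  ext i
  exact (hp i j).2 (by omega)

lemma natDegree_normalized_shear {c : K} {P : MvPolynomial (Fin 2) K}
    (hc : (topForm P).eval c ≠ 0) :
    (C (C ((topForm P).eval c)⁻¹) * shear c P).natDegree = P.totalDegree := by
  rw [natDegree_C_mul (by simpa using hc)]
  refine le_antisymm (natDegree_le_of_mem_boxed (shear_mem_boxed c P)) (le_natDegree_of_ne_zero ?_)
  rw [coeff_shear_totalDegree]
  simpa using hc

lemma good_shear {c : K} {P : MvPolynomial (Fin 2) K} (hc : (topForm P).eval c ≠ 0) :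
    Good (C (C ((topForm P).eval c)⁻¹) * shear c P) where
  monic := by
    rw [Monic, leadingCoeff, natDegree_normalized_shear hc, coeff_C_mul, coeff_shear_totalDegree,
      ← C_mul, inv_mul_cancel₀ hc, C_1]
  mem_boxed := by
    rw [natDegree_normalized_shear hc]
    have := mul_mem_boxed_top (monomial_mem_boxed (T := (⊤ : Submodule K K)) (i := 0) (j := 0)
      (t := ((topForm P).eval c)⁻¹) trivial le_rfl) (shear_mem_boxed c P)
    rwa [Nat.zero_add] at this

end

section

section Factor

variable {R : Type*} [CommRing R] [IsDomain R]

lemma totalDegree_pos_of_irreducible_map {K L σ : Type*} [Field K] [Field L] [Algebra K L]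
    {Q : MvPolynomial σ K} (h : Irreducible (MvPolynomial.map (algebraMap K L) Q)) :
    0 < Q.totalDegree := by
  by_contra h0
  have h1 : Q.totalDegree = 0 := by omega
  rw [MvPolynomial.totalDegree_eq_zero_iff_eq_C] at h1
  rw [h1, MvPolynomial.map_C] at h
  by_cases h2 : MvPolynomial.coeff 0 Q = 0
  · rw [h2, map_zero, map_zero] at h
    exact h.ne_zero rfl
  · exact h.not_isUnit (((IsUnit.mk0 _ h2).map (algebraMap K L)).map MvPolynomial.C)

lemma totalDegree_le_of_dvd {σ : Type*} {Q P : MvPolynomial σ R} (h : Q ∣ P) (hP : P ≠ 0) :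
    Q.totalDegree ≤ P.totalDegree := by
  obtain ⟨T, rfl⟩ := h
  rw [MvPolynomial.totalDegree_mul_of_isDomain (left_ne_zero_of_mul hP) (right_ne_zero_of_mul hP)]
  omega

lemma dvd_of_dvd_linear {k σ : Type*} [Field k] {Q P : MvPolynomial σ k} (h : Q ∣ P) (hP : P ≠ 0)
    (hd : P.totalDegree ≤ 1) (hQ : 0 < Q.totalDegree) : P ∣ Q := by
  obtain ⟨T, rfl⟩ := h
  rw [MvPolynomial.totalDegree_mul_of_isDomain (left_ne_zero_of_mul hP)
    (right_ne_zero_of_mul hP)] at hd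
  have hT : T.totalDegree = 0 := by omega
  have hT0 := right_ne_zero_of_mul hP
  rw [MvPolynomial.totalDegree_eq_zero_iff_eq_C] at hT
  have h0 : MvPolynomial.coeff 0 T ≠ 0 := by
    intro h0
    rw [h0, map_zero] at hT
    exact hT0 hT
  have hu : IsUnit T := by
    rw [hT]
    exact (IsUnit.mk0 _ h0).map MvPolynomial.C
  exact (hu.dvd_mul_right.1 dvd_rfl)

lemma isSquare_of_pderiv_eq_zero {k σ : Type*} [Field k] [CharP k 2] [PerfectRing k 2]
    {Q : MvPolynomial σ k} (h : ∀ i, pderiv i Q = 0) : IsSquare Q := by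
  have hmem : Q ∈ (frobenius (MvPolynomial σ k) 2).range := by
    rw [Q.as_sum]
    refine Subring.sum_mem _ fun s hs => ?_
    have heven : ∀ i, 2 ∣ s i := by
      intro i
      by_contra h2
      have hc := congrArg (MvPolynomial.coeff (s - Finsupp.single i 1)) (h i)
      have hsi : s i ≠ 0 := fun h0 => h2 (by simp [h0])
      have hle : Finsupp.single i 1 ≤ s := by
        rw [Finsupp.single_le_iff]
        omega
      rw [MvPolynomial.coeff_pderiv, tsub_add_cancel_of_le hle, MvPolynomial.coeff_zero] at hc
      rcases mul_eq_zero.1 hc with hc | hc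
      · exact MvPolynomial.mem_support_iff.1 hs hc
      · apply h2
        rw [← CharP.cast_eq_zero_iff k 2, ← hc]
        have : s i = (s i - 1) + 1 := by omega
        conv_lhs => rw [this]
        simp
    refine ⟨MvPolynomial.monomial (s.mapRange (· / 2) rfl)
      ((frobeniusEquiv k 2).symm (MvPolynomial.coeff s Q)), ?_⟩
    have h2 : 2 • s.mapRange (· / 2) rfl = s :=
      Finsupp.ext fun i => by simpa using Nat.mul_div_cancel' (heven i)
    rw [frobenius_def, MvPolynomial.monomial_pow, frobeniusEquiv_symm_pow_p, h2]
  obtain ⟨T, hT⟩ := hmem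
  exact ⟨T, by rw [← hT, frobenius_def, sq]⟩

end Factor

variable {K L : Type*} [Field K] [Field L] [Algebra K L] [IsAlgClosed L]

lemma exists_shear_parameter [Fintype K] [CharP K 2] {Q : MvPolynomial (Fin 2) K}
    (hQ : Irreducible (MvPolynomial.map (algebraMap K L) Q))
    (hq : Q.totalDegree + 1 < Fintype.card K) :
    ∃ c : K, (topForm Q).eval c ≠ 0 ∧ c • pderiv 0 Q + pderiv 1 Q ≠ 0 := by
  have : CharP L 2 := charP_of_injective_algebraMap (algebraMap K L).injective 2
  have hQ0 : Q ≠ 0 := by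
    rintro rfl
    exact hQ.ne_zero (map_zero _)
  have hw : ∃ w : K, ∀ c, c ≠ w → c • pderiv 0 Q + pderiv 1 Q ≠ 0 := by
    by_cases h0 : pderiv 0 Q = 0
    · have h1 : pderiv 1 Q ≠ 0 := by
        intro h1
        refine hQ.not_isSquare (isSquare_of_pderiv_eq_zero fun i => ?_)
        rw [MvPolynomial.pderiv_map]
        fin_cases i
        · simp [h0]
        · simp [h1]
      exact ⟨0, fun c _ => by simpa [h0] using h1⟩
    · by_contra! h
      obtain ⟨w, _, hw⟩ := h 0
      obtain ⟨w', hne, hw'⟩ := h w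
      have h1 : (w' - w) • pderiv 0 Q = 0 := by
        rw [sub_smul, sub_eq_zero]
        exact add_right_cancel (hw'.trans hw.symm)
      rcases smul_eq_zero.1 h1 with h1 | h1
      · exact hne (sub_eq_zero.1 h1)
      · exact h0 h1
  obtain ⟨w, hw⟩ := hw
  have hne : topForm Q * (X - C w) ≠ 0 := mul_ne_zero (topForm_ne_zero hQ0) (X_sub_C_ne_zero w)
  obtain ⟨c, hc⟩ : ∃ c, (topForm Q * (X - C w)).eval c ≠ 0 := by
    by_contra! h
    refine hne (eq_zero_of_natDegree_lt_card_of_eval_eq_zero _ Function.injective_id h ?_)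
    refine lt_of_le_of_lt natDegree_mul_le ?_
    rw [natDegree_X_sub_C]
    have := natDegree_topForm_le Q
    omega
  rw [eval_mul] at hc
  refine ⟨c, left_ne_zero_of_mul hc, hw c ?_⟩
  rintro rfl
  simp at hc

variable (L) in
theorem dvd_of_forall_eval_eq_zero [Fintype K] [CharP K 2] {Q E : MvPolynomial (Fin 2) K}
    (hQ : Irreducible (MvPolynomial.map (algebraMap K L) Q)) {M : ℕ}
    (hM : Fintype.card K = 2 ^ M) (hq : (Q.totalDegree + 1) ^ 4 ≤ Fintype.card K)
    (hE : E.totalDegree ≤ 2)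
    (h : ∀ x, MvPolynomial.eval x Q = 0 → MvPolynomial.eval x E = 0) : Q ∣ E := by
  have hpos := totalDegree_pos_of_irreducible_map hQ
  obtain ⟨c, hc, hd⟩ := exists_shear_parameter hQ (lt_of_lt_of_le (by
    calc Q.totalDegree + 1 = (Q.totalDegree + 1) ^ 1 := (pow_one _).symm
      _ < (Q.totalDegree + 1) ^ 4 := Nat.pow_lt_pow_right (by omega) (by omega)) hq)
  have hu : IsUnit (C (C ((topForm Q).eval c)⁻¹) : K[X][X]) :=
    ((IsUnit.mk0 _ (inv_ne_zero hc)).map C).map C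
  have hirr : Irreducible (ext L (C (C ((topForm Q).eval c)⁻¹) * shear c Q)) := by
    have h1 : ext L (C (C ((topForm Q).eval c)⁻¹) * shear c Q) =
        (mapRingHom (mapRingHom (algebraMap K L))) (C (C ((topForm Q).eval c)⁻¹)) *
          ext L (shear c Q) := by
      rw [ext, ext, Polynomial.map_mul]
      rfl
    rw [h1, irreducible_isUnit_mul (hu.map _), ext_shear]
    exact (MulEquiv.irreducible_iff (shear (algebraMap K L c))).2 hQ
  have hder : derivative (C (C ((topForm Q).eval c)⁻¹) * shear c Q) ≠ 0 := by
    rw [derivative_C_mul, derivative_shear]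
    exact mul_ne_zero hu.ne_zero ((map_ne_zero_iff _ (shear c).injective).2 hd)
  have hdvd := dvd_of_vanishing L (good_shear hc) hirr hder hM
    (by rwa [natDegree_normalized_shear hc]) (p := shear c E)
    (boxed_mono le_rfl hE (shear_mem_boxed c E)) fun u v huv => by
      rw [evalAt_shear]
      apply h
      rw [map_mul, evalAt_shear] at huv
      refine (mul_eq_zero.1 huv).resolve_left ?_
      simpa using hc
  exact (map_dvd_iff (shear c)).1 ((Dvd.intro_left _ rfl).trans hdvd)

end

section

lemma eq_two_pow_of_add_one_pow {k : Type*} [Field k] [CharP k 2] {d : ℕ} (hd : d ≠ 0)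
    (h : (X + 1 : k[X]) ^ d = X ^ d + 1) : ∃ e, d = 2 ^ e := by
  obtain ⟨e, m, hm, rfl⟩ := Nat.exists_eq_two_pow_mul_odd hd
  refine ⟨e, ?_⟩
  have h1 : expand k (2 ^ e) ((X + 1) ^ m) = expand k (2 ^ e) (X ^ m + 1) := by
    simp only [map_pow, map_add, expand_X, map_one]
    rw [← pow_mul, ← h, pow_mul, add_pow_char_pow, one_pow]
  have h2 := congrArg (fun p : k[X] => p.coeff 1) (expand_injective (by positivity) h1)
  simp only [coeff_X_add_one_pow, Nat.choose_one_right, coeff_add, coeff_X_pow, coeff_one] at h2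
  have h3 : (m : k) ≠ 0 := by
    rw [Ne, CharP.cast_eq_zero_iff k 2]
    exact hm.not_two_dvd_nat
  by_cases hm1 : m = 1
  · simp [hm1]
  · rw [if_neg (by omega)] at h2
    simp [h3] at h2

lemma add_one_mul_sum_choose_add_one {R : Type*} [CommRing R] [CharP R 2] (x : R) {i : ℕ}
    (hi : i ≠ 0) :
    (x + 1) * ∑ k ∈ Finset.range i, (((i - 1).choose k + 1 : ℕ) : R) * x ^ k =
      (x + 1) ^ i + x ^ i + 1 := by
  obtain ⟨i, rfl⟩ := Nat.exists_eq_succ_of_ne_zero hi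
  simp only [Nat.succ_eq_add_one, Nat.add_sub_cancel, Nat.cast_add, Nat.cast_one, add_mul, one_mul,
    Finset.sum_add_distrib]
  have h1 : ∑ k ∈ Finset.range (i + 1), ((i.choose k : ℕ) : R) * x ^ k = (x + 1) ^ i := by
    rw [add_pow]
    exact Finset.sum_congr rfl fun k _ => by rw [one_pow, mul_one, mul_comm]
  have h2 := mul_geom_sum x (i + 1)
  rw [CharTwo.sub_eq_add, CharTwo.sub_eq_add] at h2
  rw [h1]
  linear_combination h2

/-- The polynomial `F` associated to `f`. -/
noncomputable def assoc {K : Type*} [CommRing K] (a : ℕ → K) (d : ℕ) : MvPolynomial (Fin 2) K :=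
  (MvPolynomial.X 1) ^ (d - 2) +
      ∑ i ∈ Finset.Icc 3 d, MvPolynomial.C (a i) * (MvPolynomial.X 1) ^ (d - i) *
        ∑ k ∈ Finset.range i, MvPolynomial.C ((((i - 1).choose k + 1 : ℕ) : K)) *
          (MvPolynomial.X 0) ^ k

lemma aeval_assoc {K A : Type*} [CommRing K] [CommRing A] [Algebra K A] (a : ℕ → K) (d : ℕ)
    (x y : A) :
    MvPolynomial.aeval ![x, y] (assoc a d) = y ^ (d - 2) + ∑ i ∈ Finset.Icc 3 d,
      algebraMap K A (a i) * y ^ (d - i) *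
        ∑ k ∈ Finset.range i, (((i - 1).choose k + 1 : ℕ) : A) * x ^ k := by
  simp [assoc]

lemma aeval_assoc_zero {K A : Type*} [CommRing K] [CommRing A] [Algebra K A] (a : ℕ → K) {d : ℕ}
    (hd : 3 ≤ d) (x : A) :
    MvPolynomial.aeval ![x, 0] (assoc a d) = algebraMap K A (a d) *
        ∑ k ∈ Finset.range d, (((d - 1).choose k + 1 : ℕ) : A) * x ^ k := by
  rw [aeval_assoc, Finset.sum_eq_single d]
  · rw [zero_pow (by omega), Nat.sub_self, pow_zero, zero_add, mul_one]
  · intro i hi hid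
    rw [Finset.mem_Icc] at hi
    rw [zero_pow (by omega), mul_zero, zero_mul]
  · intro h
    exact absurd (Finset.mem_Icc.2 ⟨hd, le_rfl⟩) h

lemma totalDegree_assoc_lt {K : Type*} [CommRing K] [Nontrivial K] (a : ℕ → K) {d : ℕ}
    (hd : 3 ≤ d) : (assoc a d).totalDegree < d := by
  have h : (assoc a d).totalDegree ≤ d - 1 := by
    refine (MvPolynomial.totalDegree_add _ _).trans (max_le ?_ ?_)
    · rw [MvPolynomial.totalDegree_X_pow]
      omega
    · refine MvPolynomial.totalDegree_finsetSum_le fun i hi => ?_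
      rw [Finset.mem_Icc] at hi
      rw [mul_assoc]
      refine (MvPolynomial.totalDegree_mul _ _).trans ?_
      rw [MvPolynomial.totalDegree_C, zero_add]
      refine (MvPolynomial.totalDegree_mul _ _).trans ?_
      rw [MvPolynomial.totalDegree_X_pow]
      have h1 : (∑ k ∈ Finset.range i, MvPolynomial.C ((((i - 1).choose k + 1 : ℕ) : K)) *
          (MvPolynomial.X 0 : MvPolynomial (Fin 2) K) ^ k).totalDegree ≤ i - 1 := by
        refine MvPolynomial.totalDegree_finsetSum_le fun k hk => ?_
        rw [Finset.mem_range] at hk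
        refine (MvPolynomial.totalDegree_mul _ _).trans ?_
        rw [MvPolynomial.totalDegree_C, zero_add, MvPolynomial.totalDegree_X_pow]
        omega
      omega
  omega

lemma aeval_assoc_zero_ne_zero {K k : Type*} [Field K] [Field k] [Algebra K k] [CharP k 2]
    {a : ℕ → K} {d : ℕ} (hd : 3 ≤ d) (had : a d ≠ 0) (h2 : ∀ e, a (2 ^ e) = 0) :
    MvPolynomial.aeval ![X, 0] (assoc a d) ≠ (0 : k[X]) := by
  rw [aeval_assoc_zero _ hd]
  intro h
  rcases mul_eq_zero.1 h with h | h
  · exact had ((algebraMap K k[X]).injective (h.trans (map_zero _).symm))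
  · have h3 := add_one_mul_sum_choose_add_one (X : k[X]) (i := d) (by omega)
    rw [h, mul_zero] at h3
    obtain ⟨e, he⟩ := eq_two_pow_of_add_one_pow (k := k) (d := d) (by omega) (by
      rw [← CharTwo.add_eq_zero, ← add_assoc, ← h3])
    exact had (he ▸ h2 e)

lemma aeval_assoc_one_ne_zero {K k : Type*} [Field K] [Field k] [Algebra K k]
    (a : ℕ → K) {d : ℕ} (hd : 3 ≤ d) :
    MvPolynomial.aeval ![-1, X] (assoc a d) ≠ (0 : k[X]) := by
  rw [aeval_assoc]
  intro h
  have h1 := congrArg (fun p : k[X] => p.coeff (d - 2)) h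
  simp only [coeff_add, coeff_X_pow_self, finsetSum_coeff, coeff_zero] at h1
  rw [Finset.sum_eq_zero, add_zero] at h1
  · exact one_ne_zero h1
  · intro i hi
    rw [Finset.mem_Icc] at hi
    have h2 : (∑ j ∈ Finset.range i, (((i - 1).choose j + 1 : ℕ) : k[X]) * (-1) ^ j) =
        C (∑ j ∈ Finset.range i, (((i - 1).choose j + 1 : ℕ) : k) * (-1) ^ j) := by
      simp
    rw [h2, IsScalarTower.algebraMap_apply K k k[X], algebraMap_eq, coeff_mul_C, coeff_C_mul,
      coeff_X_pow, if_neg (by omega), mul_zero, zero_mul]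

lemma add_one_mul_eval_assoc {K : Type*} [Field K] [CharP K 2] {f : K[X]} {d : ℕ}
    (hfd : f.natDegree = d) (hd : 3 ≤ d) (h2 : ∀ e, f.coeff (2 ^ e) = 0) {x y : K} (hy : y ≠ 0) :
    (x + 1) * MvPolynomial.eval ![x, y] (assoc f.coeff d) = y ^ d *
      (f.eval (x / y) + f.eval (1 / y) + f.eval ((x + 1) / y) + f.eval 0 +
        1 / y * ((x + 1) / y)) := by
  have h1 : (x + 1) * y ^ (d - 2) = y ^ d * (1 / y * ((x + 1) / y)) := by
    obtain ⟨e, rfl⟩ := Nat.exists_eq_add_of_le' (show 2 ≤ d by omega)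
    rw [Nat.add_sub_cancel]
    field_simp
    ring
  have h3 : (x + 1) * ∑ i ∈ Finset.Icc 3 d, f.coeff i * y ^ (d - i) *
        ∑ k ∈ Finset.range i, (((i - 1).choose k + 1 : ℕ) : K) * x ^ k =
      y ^ d * (f.eval (x / y) + f.eval (1 / y) + f.eval ((x + 1) / y) + f.eval 0) := by
    simp only [eval_eq_sum_range, hfd, ← Finset.sum_add_distrib,
      Finset.mul_sum (Finset.range (d + 1)), Finset.mul_sum (Finset.Icc 3 d)]
    refine Finset.sum_subset_zero_on_sdiff (fun i hi => ?_) (fun i hi => ?_) fun i hi => ?_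
    · rw [Finset.mem_Icc] at hi
      rw [Finset.mem_range]
      omega
    · rw [Finset.mem_sdiff, Finset.mem_range, Finset.mem_Icc] at hi
      have hi3 : i = 0 ∨ i = 1 ∨ i = 2 := by omega
      rcases hi3 with rfl | rfl | rfl
      · simp only [pow_zero]
        rw [CharTwo.add_self_eq_zero, zero_add, CharTwo.add_self_eq_zero, mul_zero]
      · simp [show f.coeff 1 = 0 from h2 0]
      · simp [show f.coeff 2 = 0 from h2 1]
    · rw [Finset.mem_Icc] at hi
      have h4 := add_one_mul_sum_choose_add_one x (i := i) (by omega)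
      rw [mul_left_comm, h4, zero_pow (by omega)]
      obtain ⟨e, rfl⟩ := Nat.exists_eq_add_of_le hi.2
      rw [Nat.add_sub_cancel_left, pow_add]
      simp only [div_pow]
      field_simp
      ring
  have h5 := aeval_assoc (A := K) f.coeff d x y
  rw [MvPolynomial.aeval_eq_eval] at h5
  rw [h5, mul_add, mul_add, h1]
  simp only [Algebra.algebraMap_self, RingHom.id_apply]
  rw [h3, add_comm]

end

section

lemma mul_add_one_eq_zero_of_planar {K : Type*} [Field K] [CharP K 2] {f : K[X]} {d : ℕ}
    (hfd : f.natDegree = d) (hd : 3 ≤ d) (h2 : ∀ e, f.coeff (2 ^ e) = 0)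
    (hf : ∀ ε : K, ε ≠ 0 → Function.Injective fun x : K => f.eval (x + ε) + f.eval x + ε * x)
    {x y : K} (h : MvPolynomial.eval ![x, y] (assoc f.coeff d) = 0) : y * (x + 1) = 0 := by
  by_contra h0
  have hy := left_ne_zero_of_mul h0
  have h1 := add_one_mul_eval_assoc hfd hd h2 (x := x) hy
  rw [h, mul_zero, eq_comm, mul_eq_zero] at h1
  have h3 := h1.resolve_left (pow_ne_zero d hy)
  have h4 : (x + 1) / y + 1 / y = x / y := by
    rw [← add_div, add_assoc, CharTwo.add_self_eq_zero, add_zero]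
  have h5 := hf (1 / y) (one_div_ne_zero hy) (a₁ := (x + 1) / y) (a₂ := 0) (by
    simp only [h4, zero_add, mul_zero, add_zero]
    rw [← sub_eq_zero, CharTwo.sub_eq_add]
    linear_combination h3)
  exact div_ne_zero (right_ne_zero_of_mul h0) hy h5

lemma totalDegree_X_add_one_le (k : Type*) [Field k] :
    (MvPolynomial.X 0 + 1 : MvPolynomial (Fin 2) k).totalDegree ≤ 1 := by
  refine (MvPolynomial.totalDegree_add _ _).trans (max_le ?_ ?_)
  · exact (MvPolynomial.totalDegree_X _).le
  · simp

theorem not_planar_of_dvd_assoc {K : Type*} (L : Type*) [Field K] [Field L] [Algebra K L]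
    [IsAlgClosed L] [Fintype K] [CharP K 2] {M : ℕ} (hM : Fintype.card K = 2 ^ M) {f : K[X]} {d : ℕ}
    (hfd : f.natDegree = d) (hd : 3 ≤ d) (hq : d ^ 4 ≤ Fintype.card K)
    (h2 : ∀ e, f.coeff (2 ^ e) = 0) {Q : MvPolynomial (Fin 2) K} (hQF : Q ∣ assoc f.coeff d)
    (hQ : Irreducible (MvPolynomial.map (algebraMap K L) Q)) :
    ¬ ∀ ε : K, ε ≠ 0 → Function.Injective fun x : K => f.eval (x + ε) + f.eval x + ε * x := by
  intro hf
  have : CharP L 2 := charP_of_injective_algebraMap (algebraMap K L).injective 2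
  have hfd0 : f.coeff d ≠ 0 := by
    rw [← hfd]
    exact leadingCoeff_ne_zero.2 (by rintro rfl; simp at hfd; omega)
  have hF := aeval_assoc_zero_ne_zero (k := L) hd hfd0 h2
  have hF1 := aeval_assoc_one_ne_zero (k := L) f.coeff hd
  have hF0 : assoc f.coeff d ≠ 0 := by
    intro h
    rw [h, map_zero] at hF
    exact hF rfl
  have hdeg : Q.totalDegree + 1 ≤ d :=
    (totalDegree_le_of_dvd hQF hF0).trans_lt (totalDegree_assoc_lt _ hd)
  have hdvd : Q ∣ MvPolynomial.X 1 * (MvPolynomial.X 0 + 1) := by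
    refine dvd_of_forall_eval_eq_zero L hQ hM ((Nat.pow_le_pow_left hdeg 4).trans hq) ?_ ?_
    · refine (MvPolynomial.totalDegree_mul _ _).trans ?_
      rw [MvPolynomial.totalDegree_X]
      have := totalDegree_X_add_one_le K
      omega
    · intro x hx
      have hx2 : x = ![x 0, x 1] := by
        ext i
        fin_cases i <;> rfl
      have h0 : MvPolynomial.eval x (assoc f.coeff d) = 0 := by
        obtain ⟨T, hT⟩ := hQF
        rw [hT, map_mul, hx, zero_mul]
      rw [hx2] at h0
      simpa using mul_add_one_eq_zero_of_planar hfd hd h2 hf h0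
  have hpos := totalDegree_pos_of_irreducible_map (K := L) (L := L)
    (Q := MvPolynomial.map (algebraMap K L) Q) (by
      rwa [show algebraMap L L = RingHom.id L from rfl, MvPolynomial.map_id])
  have hdvdF := _root_.map_dvd (MvPolynomial.map (algebraMap K L)) hQF
  have hmap : ∀ v : Fin 2 → L[X], MvPolynomial.aeval v (assoc f.coeff d) =
      MvPolynomial.aeval v (MvPolynomial.map (algebraMap K L) (assoc f.coeff d)) := fun v =>
    (MvPolynomial.aeval_map_algebraMap L v _).symm
  rw [hmap] at hF hF1
  have hcase := _root_.map_dvd (MvPolynomial.map (algebraMap K L)) hdvd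
  rw [map_mul, map_add, MvPolynomial.map_X, MvPolynomial.map_X, map_one] at hcase
  rcases hQ.prime.dvd_or_dvd hcase with h | h
  · obtain ⟨T, hT⟩ := (dvd_of_dvd_linear h (MvPolynomial.X_ne_zero 1)
      (MvPolynomial.totalDegree_X _).le hpos).trans hdvdF
    rw [hT] at hF
    simp at hF
  · have hne : (MvPolynomial.X 0 + 1 : MvPolynomial (Fin 2) L) ≠ 0 := by
      intro h
      simpa using congrArg (MvPolynomial.eval 0) h
    obtain ⟨T, hT⟩ := (dvd_of_dvd_linear h hne (totalDegree_X_add_one_le L) hpos).trans hdvdF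
    rw [hT] at hF1
    simp at hF1

end

end Polynomial.PlaneCurve

theorem abs_irr_factor_implies_not_planar
    {K : Type*} [Field K] [Fintype K] (n : ℕ) (hn : 1 ≤ n)
    (hcard : Fintype.card K = 2 ^ n)
    (f : Polynomial K) (d : ℕ) (hd : f.natDegree = d) (hd3 : 3 ≤ d)
    (hAd : f.coeff d ≠ 0)
    (hdeg : d ^ 4 ≤ Fintype.card K)
    (h2 : ∀ i k : ℕ, i = 2 ^ k → f.coeff i = 0)
    (F : MvPolynomial (Fin 2) K)
    (hF : F = (X 1 : MvPolynomial (Fin 2) K) ^ (d - 2) +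
      ∑ i ∈ Finset.Icc 3 d, C (f.coeff i) * (X 1) ^ (d - i) *
        ∑ k ∈ Finset.range i, C ((((i - 1).choose k + 1 : ℕ) : K)) * (X 0) ^ k)
    (hirr : HasAbsIrrFactor F) :
    ¬ ∀ ε : K, ε ≠ 0 →
      Function.Bijective fun x : K => f.eval (x + ε) + f.eval x + ε * x := by
  have : CharP K 2 := charP_of_card_eq_prime_pow hcard
  obtain ⟨Q, hQF, -, hQ⟩ := hirr
  rw [hF] at hQF
  exact fun hf => Polynomial.PlaneCurve.not_planar_of_dvd_assoc (AlgebraicClosure K) hcard hd hd3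
    hdeg (fun e => h2 _ e rfl) hQF hQ fun ε hε => (hf ε hε).injective
end

section
/- Let G ∈ F_q[X,Y] be a nonzero polynomial, let n be the smallest total degree of a monomial occurring in G, and let H ∈ F_q[X,Y] be the polynomial satisfying H(X,Y)·X^n = G(X, X·Y) (such H exists). If H has an absolutely irreducible factor in F_q[X,Y], then G has an absolutely irreducible factor in F_q[X,Y]. -/
open MvPolynomial

namespace MvPolynomial

variable {k : Type*} [Field k]

/-- The substitution `G(X, Y) ↦ G(X, X * Y)`. -/
noncomputable def blowup (k : Type*) [Field k] :
    MvPolynomial (Fin 2) k →ₐ[k] MvPolynomial (Fin 2) k :=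
  aeval ![X 0, X 0 * X 1]

@[simp] lemma blowup_X_zero : blowup k (X 0) = X 0 := by simp [blowup]

@[simp] lemma blowup_X_one : blowup k (X 1) = X 0 * X 1 := by simp [blowup]

lemma blowup_monomial (s : Fin 2 →₀ ℕ) (a : k) :
    blowup k (monomial s a) = monomial (s + Finsupp.single 0 (s 1)) a := by
  rw [blowup, aeval_monomial, Finsupp.prod_fintype _ _ (by simp), Fin.prod_univ_two]
  have h : (s : Fin 2 →₀ ℕ) = Finsupp.single 0 (s 0) + Finsupp.single 1 (s 1) := by
    ext i; fin_cases i <;> simp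
  conv_rhs => rw [h, ← mul_one a]
  simp only [Matrix.cons_val_zero, Matrix.cons_val_one, algebraMap_eq, mul_pow]
  simp only [X_pow_eq_monomial, C_mul_monomial, monomial_mul, mul_one]
  congr 2
  simp
  abel

lemma coeff_blowup (G : MvPolynomial (Fin 2) k) (s : Fin 2 →₀ ℕ) :
    coeff (s + Finsupp.single 0 (s 1)) (blowup k G) = coeff s G := by
  induction G using MvPolynomial.induction_on' with
  | add p q hp hq => simp [hp, hq]
  | monomial t a =>
    have h : t + Finsupp.single 0 (t 1) = s + Finsupp.single 0 (s 1) ↔ t = s := by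
      refine ⟨fun h => ?_, by rintro rfl; rfl⟩
      have h₀ := DFunLike.congr_fun h 0
      have h₁ := DFunLike.congr_fun h 1
      simp at h₀ h₁
      ext i; fin_cases i <;> simp <;> omega
    simp only [blowup_monomial, coeff_monomial, h]

lemma blowup_injective : Function.Injective (blowup k) := fun A B h => by
  ext s
  rw [← coeff_blowup A, ← coeff_blowup B, h]

lemma map_blowup {L : Type*} [Field L] (f : k →+* L) (G : MvPolynomial (Fin 2) k) :
    map f (blowup k G) = blowup L (map f G) := by
  induction G using MvPolynomial.induction_on' with
  | add p q hp hq => simp [hp, hq]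
  | monomial t a => simp [blowup_monomial]

lemma exists_blowup_eq_X_pow_mul (Q : MvPolynomial (Fin 2) k) :
    ∃ m R, blowup k R = X 0 ^ m * Q := by
  induction Q using MvPolynomial.induction_on with
  | C a => exact ⟨0, C a, by simp [blowup]⟩
  | add p q hp hq =>
    obtain ⟨m, R, hR⟩ := hp
    obtain ⟨l, S, hS⟩ := hq
    exact ⟨m + l, X 0 ^ l * R + X 0 ^ m * S, by simp [hR, hS]; ring⟩
  | mul_X p i hp =>
    obtain ⟨m, R, hR⟩ := hp
    refine ⟨m + 1, R * ![X 0 * X 0, X 1] i, ?_⟩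
    fin_cases i <;> simp [hR] <;> ring

/-- The strict transform: every `Q` prime to `X` is, up to a power of `X`, the image under
`blowup` of a polynomial prime to `X`. -/
lemma exists_blowup_eq_X_pow_mul_of_not_dvd {Q : MvPolynomial (Fin 2) k} (hQ : ¬ X 0 ∣ Q) :
    ∃ m R, blowup k R = X 0 ^ m * Q ∧ ¬ X 0 ∣ R := by
  classical
  have h := exists_blowup_eq_X_pow_mul Q
  obtain ⟨R, hR⟩ := Nat.find_spec h
  refine ⟨Nat.find h, R, hR, ?_⟩
  rintro ⟨R', rfl⟩
  rw [map_mul, blowup_X_zero] at hR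
  rcases hm : Nat.find h with _ | m
  · rw [hm, pow_zero, one_mul] at hR
    exact hQ ⟨_, hR.symm⟩
  · rw [hm, pow_succ', mul_assoc] at hR
    exact Nat.find_min h (hm ▸ Nat.lt_succ_self m) ⟨R', mul_left_cancel₀ (X_ne_zero 0) hR⟩

lemma dvd_of_dvd_blowup {Q R G : MvPolynomial (Fin 2) k} {m : ℕ}
    (hR : blowup k R = X 0 ^ m * Q) (hX : ¬ X 0 ∣ R) (hQ : Q ∣ blowup k G) : R ∣ G := by
  obtain ⟨T, hT⟩ := hQ
  obtain ⟨l, S, hS⟩ := exists_blowup_eq_X_pow_mul T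
  have h : R * S = X 0 ^ (m + l) * G := blowup_injective <| by
    simp only [map_mul, map_pow, blowup_X_zero, hR, hS, hT]; ring
  obtain ⟨S', rfl⟩ := (X_prime (R := k) (i := (0 : Fin 2))).pow_dvd_of_dvd_mul_left _ hX ⟨G, h⟩
  refine ⟨S', mul_left_cancel₀ (pow_ne_zero (m + l) (X_ne_zero (R := k) (0 : Fin 2))) ?_⟩
  rw [← h]; ring

lemma irreducible_of_blowup {Q R : MvPolynomial (Fin 2) k} {m : ℕ}
    (hR : blowup k R = X 0 ^ m * Q) (hX : ¬ X 0 ∣ R) (hQ : Irreducible Q) : Irreducible R := by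
  have key : ∀ A B, R = A * B → Q ∣ blowup k A → IsUnit B := by
    rintro A B rfl ⟨C', hC⟩
    rw [map_mul, hC] at hR
    have hB : blowup k B ∣ X 0 ^ m :=
      ⟨C', mul_left_cancel₀ hQ.ne_zero (by rw [mul_comm, ← hR]; ring)⟩
    obtain ⟨j, -, u, hu⟩ := (dvd_prime_pow (X_prime (R := k) (i := (0 : Fin 2))) m).1 hB
    obtain ⟨v, hv⟩ : ∃ v : (MvPolynomial (Fin 2) k)ˣ, blowup k (v : MvPolynomial (Fin 2) k) = u := by
      obtain ⟨c, hc, h⟩ := MvPolynomial.isUnit_iff_eq_C_of_isReduced.1 u.isUnit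
      exact ⟨(hc.map C).unit, by simp [h, blowup]⟩
    have hBv : B * (v : MvPolynomial (Fin 2) k) = X 0 ^ j := blowup_injective <| by simp [hv, hu]
    rcases j with _ | j
    · exact .of_mul_eq_one _ (by simpa using hBv)
    · refine absurd (Dvd.dvd.mul_left ?_ A) hX
      rw [← v.isUnit.dvd_mul_right, hBv]
      exact dvd_pow_self _ j.succ_ne_zero
  refine ⟨fun h => hQ.not_isUnit ?_, fun A B h => ?_⟩
  · exact isUnit_of_dvd_unit ⟨_, by rw [hR, mul_comm]⟩ (h.map (blowup k))
  · have : Q ∣ blowup k A * blowup k B := by rw [← map_mul, ← h, hR]; exact dvd_mul_left _ _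
    rcases hQ.prime.dvd_or_dvd this with hA | hB
    · exact .inr (key A B h hA)
    · exact .inl (key B A (h.trans (mul_comm _ _)) hB)

lemma X_dvd_map_iff {σ L : Type*} [Field L] (f : k →+* L) (i : σ) (P : MvPolynomial σ k) :
    X i ∣ map f P ↔ X i ∣ P := by
  have h : (map f P).modMonomial (Finsupp.single i 1) =
      map f (P.modMonomial (Finsupp.single i 1)) := by
    ext s
    by_cases hs : Finsupp.single i 1 ≤ s
    · simp [coeff_modMonomial_of_le _ hs, coeff_map]
    · simp [coeff_modMonomial_of_not_le _ hs, coeff_map]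
  rw [X_dvd_iff_modMonomial_eq_zero, X_dvd_iff_modMonomial_eq_zero, h,
    map_eq_zero_iff _ (map_injective f f.injective)]

end MvPolynomial

theorem abs_irr_factor_transfer
    {K : Type*} [Field K] [Fintype K]
    (G H : MvPolynomial (Fin 2) K) (hG : G ≠ 0) (n : ℕ)
    (hn : IsLeast {m : ℕ | ∃ s ∈ G.support, (s.sum fun _ e => e) = m} n)
    (hH : H * (X 0 : MvPolynomial (Fin 2) K) ^ n = aeval ![X 0, X 0 * X 1] G)
    (hirr : HasAbsIrrFactor H) :
    HasAbsIrrFactor G := by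
  change H * X 0 ^ n = blowup K G at hH
  obtain ⟨Q, hQH, -, hQ⟩ := hirr
  have hXH : ¬ X 0 ∣ H := by
    rintro ⟨H', rfl⟩
    obtain ⟨s, hs, hsn⟩ := hn.1
    rw [Finsupp.sum_fintype _ _ (fun _ => rfl), Fin.sum_univ_two] at hsn
    rw [mem_support_iff, ← coeff_blowup, ← hH] at hs
    apply hs
    have : X 0 * H' * X 0 ^ n = monomial (Finsupp.single 0 (n + 1)) 1 * H' := by
      rw [← X_pow_eq_monomial]; ring
    rw [this, coeff_monomial_mul', if_neg]
    intro hle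
    have := hle 0
    simp at this
    omega
  obtain ⟨m, R, hR, hXR⟩ := exists_blowup_eq_X_pow_mul_of_not_dvd fun h => hXH (h.trans hQH)
  have hirrR : Irreducible (map (algebraMap K (AlgebraicClosure K)) R) :=
    irreducible_of_blowup (m := m) (by rw [← map_blowup, hR]; simp)
      (mt (X_dvd_map_iff _ 0 R).1 hXR) hQ
  refine ⟨R, dvd_of_dvd_blowup hR hXR (hH ▸ hQH.mul_right _), ?_, hirrR⟩
  rw [Nat.pos_iff_ne_zero]
  intro h
  rw [totalDegree_eq_zero_iff_eq_C.1 h, map_C] at hirrR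
  rcases eq_or_ne (coeff 0 R) 0 with h₀ | h₀
  · exact hirrR.ne_zero (by simp [h₀])
  · exact hirrR.not_isUnit (((isUnit_iff_ne_zero.2 h₀).map _).map C)
end

section
/- Assume the Section 3 setup, with u the least nonnegative integer such that the tangent cone of F_{t-1} contains a monomial X^{2^u}Y^ℓ for some ℓ. Define, for 3 ≤ i ≤ d, o(i) = 2^{u-1}(t+1) - 1 - 2^{u-1}·i + 2^u + 2 if i is odd, and o(i) = (2^{v₂(i)} + 1)(2^{u-1}(t+1) - 1) - 2^{u-1}·i + 2^u + 2 if i is even, where v₂ is the 2-adic valuation, and let m = min{ o(i) : 3 ≤ i ≤ d, A_i ≠ 0 }. Then there is exactly one index i with 3 ≤ i ≤ d and A_i ≠ 0 such that o(i) = m. -/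
open MvPolynomial

noncomputable section

/-- The smallest total degree of a monomial occurring in `P`. -/
def minMonomialDeg {K : Type*} [Field K] (P : MvPolynomial (Fin 2) K) : ℕ :=
  sInf {m : ℕ | ∃ s ∈ P.support, (s.sum fun _ e => e) = m}

/-- The tangent cone of `P` at the origin: the nonzero homogeneous component of
lowest total degree (for `P ≠ 0`). -/
def tangentCone {K : Type*} [Field K] (P : MvPolynomial (Fin 2) K) : MvPolynomial (Fin 2) K :=
  homogeneousComponent (minMonomialDeg P) P

set_option maxHeartbeats 1000000 in
theorem eq_of_min_order {S : Set ℕ} {t u i₀ : ℕ}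
    (hS3 : ∀ i ∈ S, 3 ≤ i)
    (hSle : ∀ i ∈ S, i ≤ (t + 1) * 2 ^ padicValNat 2 i + 2)
    (hSmin : ∀ i ∈ S, t * 2 ^ u + i ≤ t * 2 ^ padicValNat 2 i + i₀)
    (hi₀ : i₀ ∈ S) (hu : padicValNat 2 i₀ = u) (hlt : t * 2 ^ u + 2 < i₀)
    {o : ℕ → ℤ}
    (hoodd : ∀ i : ℕ, Odd i →
      o i = 2 ^ (u - 1) * ((t : ℤ) + 1) - 1 - 2 ^ (u - 1) * (i : ℤ) + 2 ^ u + 2)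
    (hoeven : ∀ i : ℕ, Even i →
      o i = (2 ^ (padicValNat 2 i) + 1) * (2 ^ (u - 1) * ((t : ℤ) + 1) - 1)
        - 2 ^ (u - 1) * (i : ℤ) + 2 ^ u + 2)
    {i i' : ℕ} (hi : i ∈ S) (hi' : i' ∈ S) (hle : ∀ k ∈ S, o i ≤ o k) (heq : o i = o i') :
    i = i' := by
  have key : ∀ k ∈ S, ∃ j : ℕ, j % 2 = 1 ∧ k = 2 ^ padicValNat 2 k * j := by
    intro k hk
    have hk0 : k ≠ 0 := by have := hS3 k hk; omega
    obtain ⟨j, hj⟩ := pow_padicValNat_dvd (p := 2) (n := k)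
    refine ⟨j, ?_, hj⟩
    by_contra h
    obtain ⟨l, rfl⟩ : 2 ∣ j := by omega
    exact pow_succ_padicValNat_not_dvd (p := 2) hk0 ⟨l, by rw [pow_succ, mul_assoc]; exact hj⟩
  have vodd : ∀ k : ℕ, Odd k → padicValNat 2 k = 0 := fun k hk =>
    padicValNat.eq_zero_of_not_dvd (by have := Nat.odd_iff.1 hk; omega)
  have veven : ∀ k ∈ S, Even k → 1 ≤ padicValNat 2 k := fun k hk he =>
    one_le_padicValNat_of_dvd (by have := hS3 k hk; omega) he.two_dvd
  obtain ⟨j₀, hj₀, hij₀⟩ := key i₀ hi₀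
  have hi₀le := hSle i₀ hi₀
  rw [hu] at hij₀ hi₀le
  obtain rfl | rfl | hu2 : u = 0 ∨ u = 1 ∨ 2 ≤ u := by omega
  · -- the minimum is attained only at `i₀ = t + 3`
    have h₀ : i₀ = t + 3 := by omega
    have ho₀ : o i₀ = 0 := by
      rw [hoodd i₀ (Nat.odd_iff.2 (by omega)), h₀]; push_cast; ring
    have pos : ∀ k ∈ S, k ≠ i₀ → 0 < o k := by
      intro k hk hne
      obtain ⟨j, hj, hkj⟩ := key k hk
      have h1 := hSle k hk
      have h2 := hSmin k hk
      rcases Nat.even_or_odd k with he | ho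
      · have hv := veven k hk he
        obtain ⟨e, hev⟩ : ∃ e, padicValNat 2 k = e + 1 := ⟨_, (Nat.sub_add_cancel hv).symm⟩
        have hek := hoeven k he
        rw [hev] at h1 h2 hkj hek
        have hp : 1 ≤ 2 ^ e := Nat.one_le_two_pow
        generalize hP : 2 ^ e = P at *
        have hPz : (2 : ℤ) ^ (e + 1) = 2 * (P : ℤ) := by rw [pow_succ, ← hP]; push_cast; ring
        rw [pow_succ, hP] at h1 h2 hkj
        have hjle : j ≤ t + 1 := by
          by_contra hcon
          have : t + 3 ≤ j := by omega
          nlinarith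
        rw [hek, hPz]
        simp only [hkj]
        push_cast
        obtain rfl | hjl : j = t + 1 ∨ j + 1 ≤ t := by omega
        · have : P = 1 := by nlinarith
          subst this; push_cast; nlinarith
        · zify at hjl hp
          nlinarith
      · have := vodd k ho
        rw [this] at h1
        rw [hoodd k ho]
        simp only [zero_tsub, pow_zero]
        omega
    have hi0 : i = i₀ := by
      by_contra h
      have := pos i hi h
      have := hle i₀ hi₀
      omega
    by_contra h
    have := pos i' hi' (by rintro rfl; exact h hi0)
    rw [hi0] at heq
    omega
  · have h₀ : i₀ = 2 * (t + 2) := by omega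
    have ev₀ : Even i₀ := ⟨t + 2, by omega⟩
    have ho₀ : o i₀ = t := by
      rw [hoeven i₀ ev₀, hu, h₀]; push_cast; ring
    have pos : ∀ k ∈ S, Even k → k ≠ i₀ → (t : ℤ) < o k := by
      intro k hk he hne
      obtain ⟨j, hj, hkj⟩ := key k hk
      have h1 := hSle k hk
      have hv := veven k hk he
      obtain ⟨e, hev⟩ : ∃ e, padicValNat 2 k = e + 1 := ⟨_, (Nat.sub_add_cancel hv).symm⟩
      have hek := hoeven k he
      rw [hev] at h1 hkj hek
      have hp : 1 ≤ 2 ^ e := Nat.one_le_two_pow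
      generalize hP : 2 ^ e = P at *
      have hPz : (2 : ℤ) ^ (e + 1) = 2 * (P : ℤ) := by rw [pow_succ, ← hP]; push_cast; ring
      rw [pow_succ, hP] at h1 hkj
      have hjle : j ≤ t := by
        by_contra hcon
        have : t + 2 ≤ j := by omega
        have : P = 1 := by nlinarith
        subst this
        omega
      rw [hek, hPz]
      simp only [hkj]
      push_cast
      zify at hjle hp
      nlinarith
    have par : ∀ k ∈ S, Even k → o k % 2 = 1 := by
      intro k hk he
      have hv := veven k hk he
      obtain ⟨e, hev⟩ : ∃ e, padicValNat 2 k = e + 1 := ⟨_, (Nat.sub_add_cancel hv).symm⟩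
      obtain ⟨a, ha⟩ := he
      obtain ⟨b, hb⟩ : ∃ b, t = 2 * b + 1 := ⟨t / 2, by omega⟩
      have : o k = 2 * (2 ^ e * t + b - a + 2) + 1 := by
        rw [hoeven k ⟨a, ha⟩, hev, ha, hb]; push_cast; ring
      omega
    have par' : ∀ k, Odd k → o k = t + 4 - k := by
      intro k ho
      rw [hoodd k ho]; simp only [tsub_self, pow_zero]; ring
    have tri : ∀ k ∈ S, o k = o i → Even k → k = i₀ := by
      intro k hk hok he
      by_contra h
      have := pos k hk he h
      have := hle i₀ hi₀
      omega
    rcases Nat.even_or_odd i with he | ho <;> rcases Nat.even_or_odd i' with he' | ho'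
    · rw [tri i hi rfl he, tri i' hi' heq.symm he']
    · have := par i hi he
      have := par' i' ho'
      obtain ⟨a, ha⟩ := ho'
      omega
    · have := par i' hi' he'
      have := par' i ho
      obtain ⟨a, ha⟩ := ho
      omega
    · have := par' i ho
      have := par' i' ho'
      omega
  · obtain ⟨c, rfl⟩ := Nat.exists_eq_add_of_le' hu2
    have hC : 1 ≤ 2 ^ c := Nat.one_le_two_pow
    have ht : t % 2 = 0 := by
      rw [pow_add] at hij₀ hi₀le hlt
      generalize 2 ^ c = C at *
      have h1 : j₀ ≤ t + 1 := by
        by_contra h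
        have : t + 2 ≤ j₀ := by omega
        nlinarith
      have h2 : t < j₀ := by
        by_contra h
        have : j₀ ≤ t := by omega
        nlinarith
      omega
    have hw : (2 : ℤ) ^ (c + 2 - 1) = 2 * 2 ^ c := by
      rw [show c + 2 - 1 = c + 1 by omega, pow_succ]; ring
    rw [hw] at hoodd hoeven
    -- two even indices with distinct valuations
    have ee : ∀ a ∈ S, ∀ b ∈ S, Even a → Even b → o a = o b →
        ¬ padicValNat 2 a < padicValNat 2 b := by
      intro a ha b hb hae hbe hab hv
      obtain ⟨ja, hja, haj⟩ := key a ha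
      obtain ⟨jb, hjb, hbj⟩ := key b hb
      rw [hoeven a hae, hoeven b hbe] at hab
      generalize padicValNat 2 a = va at *
      obtain ⟨e, he⟩ : ∃ e, padicValNat 2 b = va + (e + 1) :=
        ⟨padicValNat 2 b - va - 1, by omega⟩
      rw [he] at hab hbj
      rw [haj, hbj] at hab
      push_cast at hab
      have hne : (2 : ℤ) ^ va ≠ 0 := by positivity
      have h : (2 ^ (e + 1) - 1) * (2 * 2 ^ c * ((t : ℤ) + 1) - 1)
          = 2 * 2 ^ c * (2 ^ (e + 1) * jb - ja) := by
        apply mul_left_cancel₀ hne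
        rw [pow_add] at hab
        linear_combination -hab
      rw [pow_succ] at h
      have h' : 2 * ((2 : ℤ) ^ e * (2 * 2 ^ c * ((t : ℤ) + 1) - 1) - 2 ^ c * (t + 1)
          - 2 ^ c * (2 ^ e * 2 * jb - ja)) = -1 := by linear_combination h
      omega
    have oe : ∀ a ∈ S, ∀ b ∈ S, Odd a → Even b → o a ≠ o b := by
      intro a ha b hb hao hbe hab
      obtain ⟨jb, hjb, hbj⟩ := key b hb
      have ha3 := hS3 a ha
      have hb1 := hSle b hb
      have hv1 := veven b hb hbe
      rw [hoodd a hao, hoeven b hbe] at hab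
      have hab' : (2 : ℤ) ^ padicValNat 2 b * (2 ^ (c + 1) * ((t : ℤ) + 1) - 1)
          = 2 ^ (c + 1) * ((b : ℤ) - a) := by rw [pow_succ]; linear_combination -hab
      have hodd : ((b : ℤ) - a) % 2 = 1 := by
        obtain ⟨x, hx⟩ := hao
        obtain ⟨y, hy⟩ := hbe
        omega
      generalize padicValNat 2 b = v at *
      obtain hvc | rfl | hvc := lt_trichotomy v (c + 1)
      · obtain ⟨e, he⟩ : ∃ e, c + 1 = v + (e + 1) := ⟨c - v, by omega⟩
        have h : (2 ^ (c + 1) * ((t : ℤ) + 1) - 1) = 2 ^ (e + 1) * ((b : ℤ) - a) := by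
          apply mul_left_cancel₀ (show (2 : ℤ) ^ v ≠ 0 by positivity)
          rw [hab', ← mul_assoc, ← pow_add, he]
        rw [pow_succ, pow_succ] at h
        have : 2 * ((2 : ℤ) ^ c * (t + 1) - 2 ^ e * (b - a)) = 1 := by linear_combination h
        omega
      · have h := mul_left_cancel₀ (show (2 : ℤ) ^ (c + 1) ≠ 0 by positivity) hab'
        obtain ⟨s, hs⟩ : ∃ s, t = 2 * s := ⟨t / 2, by omega⟩
        obtain ⟨l, hl⟩ : ∃ l, jb = 2 * l + 1 := ⟨jb / 2, by omega⟩
        have hb2 : (b : ℤ) ≤ ((t : ℤ) + 1) * 2 ^ (c + 1) + 2 := by exact_mod_cast hb1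
        have hb3 : (b : ℤ) = ((t : ℤ) + 1) * 2 ^ (c + 1) + 2 := by
          have : (3 : ℤ) ≤ a := by exact_mod_cast ha3
          linarith
        have hbj' : (b : ℤ) = 2 ^ (c + 1) * jb := by exact_mod_cast hbj
        rw [hbj', hl, hs, pow_succ] at hb3
        push_cast at hb3
        have : 2 * ((2 : ℤ) ^ c * (l - s)) = 1 := by linarith
        omega
      · obtain ⟨e, rfl⟩ : ∃ e, v = c + 1 + (e + 1) := ⟨v - c - 2, by omega⟩
        have h : (2 : ℤ) ^ (e + 1) * (2 ^ (c + 1) * ((t : ℤ) + 1) - 1) = (b : ℤ) - a := by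
          apply mul_left_cancel₀ (show (2 : ℤ) ^ (c + 1) ≠ 0 by positivity)
          rw [← hab', ← mul_assoc, ← pow_add]
        have : (b : ℤ) - a = 2 * (2 ^ e * (2 ^ (c + 1) * ((t : ℤ) + 1) - 1)) := by
          rw [← h, pow_succ 2 e]; ring
        omega
    have hne : (2 : ℤ) * 2 ^ c ≠ 0 := by positivity
    rcases Nat.even_or_odd i with he | ho <;> rcases Nat.even_or_odd i' with he' | ho'
    · have hv : padicValNat 2 i = padicValNat 2 i' :=
        le_antisymm (not_lt.1 (ee i' hi' i hi he' he heq.symm))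
          (not_lt.1 (ee i hi i' hi' he he' heq))
      rw [hoeven i he, hoeven i' he', hv] at heq
      have : (i : ℤ) = i' := mul_left_cancel₀ hne (by linarith)
      exact_mod_cast this
    · exact absurd heq.symm (oe i' hi' i hi ho' he)
    · exact absurd heq (oe i hi i' hi' ho he')
    · rw [hoodd i ho, hoodd i' ho'] at heq
      have : (i : ℤ) = i' := mul_left_cancel₀ hne (by linarith)
      exact_mod_cast this

theorem odd_choose_of_lt_two_pow {v i k : ℕ} (hi : i ≠ 0) (hvi : 2 ^ v ∣ i) (hk : k < 2 ^ v) :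
    Odd ((i - 1).choose k) := by
  obtain ⟨a, rfl⟩ := Nat.exists_eq_succ_of_ne_zero hi
  induction k with
  | zero => simp
  | succ k ih =>
    have hprev : Odd (a.choose k) := ih (by omega)
    have heven : Even ((a + 1).choose (k + 1)) := by
      by_contra h
      rw [Nat.not_even_iff_odd] at h
      have hdvd : 2 ^ v ∣ (a + 1).choose (k + 1) * (k + 1) :=
        Nat.add_one_mul_choose_eq a k ▸ Dvd.dvd.mul_right hvi _
      have := Nat.le_of_dvd k.succ_pos
        ((Nat.Coprime.pow_left v (Nat.coprime_two_left.2 h)).dvd_of_dvd_mul_left hdvd)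
      omega
    rw [Nat.choose_succ_succ] at heven
    simp only [Nat.succ_eq_add_one, Nat.add_sub_cancel]
    grind

theorem even_choose_two_pow_padicValNat {i : ℕ} (hi : i ≠ 0) :
    Even ((i - 1).choose (2 ^ padicValNat 2 i)) := by
  have hlow := odd_choose_of_lt_two_pow hi (pow_padicValNat_dvd (p := 2) (n := i))
    (Nat.sub_lt Nat.one_le_two_pow one_pos)
  have hnd := pow_succ_padicValNat_not_dvd (p := 2) hi
  obtain ⟨j, hj⟩ := pow_padicValNat_dvd (p := 2) (n := i)
  generalize padicValNat 2 i = v at *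
  obtain ⟨b, hb⟩ : ∃ b, 2 ^ v = b + 1 := ⟨2 ^ v - 1, by have := Nat.one_le_two_pow (n := v); omega⟩
  have hodd : Odd j := by
    by_contra h
    obtain ⟨l, rfl⟩ := (Nat.not_odd_iff_even.1 h).two_dvd
    exact hnd ⟨l, by rw [pow_succ, mul_assoc]; exact hj⟩
  obtain ⟨a, rfl⟩ := Nat.exists_eq_succ_of_ne_zero hi
  simp only [Nat.succ_eq_add_one, Nat.add_sub_cancel] at *
  rw [hb] at hlow hj ⊢
  have h : (a + 1).choose (b + 1) = j * a.choose b := by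
    apply Nat.eq_of_mul_eq_mul_right b.succ_pos
    rw [Nat.succ_eq_add_one, ← Nat.add_one_mul_choose_eq, hj]
    ring
  rw [Nat.add_sub_cancel] at hlow
  have hodd' := hodd.mul hlow
  rw [← h, Nat.choose_succ_succ] at hodd'
  simp only [Nat.succ_eq_add_one] at hodd'
  grind

/-- The exponent vector of the monomial `X ^ k * Y ^ j`. -/
def expVec (k j : ℕ) : Fin 2 →₀ ℕ := Finsupp.single 0 k + Finsupp.single 1 j

@[simp] theorem expVec_zero (k j : ℕ) : expVec k j 0 = k := by simp [expVec]

@[simp] theorem expVec_one (k j : ℕ) : expVec k j 1 = j := by simp [expVec]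

theorem expVec_apply (s : Fin 2 →₀ ℕ) : expVec (s 0) (s 1) = s := by
  ext i; fin_cases i <;> simp

theorem expVec_inj {k j k' j' : ℕ} : expVec k j = expVec k' j' ↔ k = k' ∧ j = j' :=
  ⟨fun h => ⟨by simpa using DFunLike.congr_fun h 0, by simpa using DFunLike.congr_fun h 1⟩,
    by rintro ⟨rfl, rfl⟩; rfl⟩

theorem degree_expVec (k j : ℕ) : (expVec k j).degree = k + j := by
  simp [expVec]

theorem sum_expVec (k j : ℕ) : ((expVec k j).sum fun _ e => e) = k + j := by
  rw [← degree_expVec]; rfl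

section

variable {K : Type*} [Field K]

theorem monomial_expVec (k j : ℕ) (a : K) :
    monomial (expVec k j) a = C a * X 0 ^ k * X 1 ^ j := by
  simp [expVec, X_pow_eq_monomial, C_mul_monomial, monomial_mul]

theorem coeff_aeval_blowup (P : MvPolynomial (Fin 2) K) (k j : ℕ) :
    (aeval ![X 0 * X 1, X 1] P : MvPolynomial (Fin 2) K).coeff (expVec k j) =
      if k ≤ j then P.coeff (expVec k (j - k)) else 0 := by
  classical
  induction P using MvPolynomial.induction_on' with
  | monomial s a =>
    obtain ⟨x, y, rfl⟩ : ∃ x y, s = expVec x y := ⟨_, _, (expVec_apply s).symm⟩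
    have h : (aeval ![X 0 * X 1, X 1] (monomial (expVec x y) a) : MvPolynomial (Fin 2) K) =
        monomial (expVec x (x + y)) a := by
      rw [monomial_expVec, monomial_expVec]
      simp only [map_mul, map_pow, aeval_X, algHom_C, algebraMap_eq, Matrix.cons_val_zero,
        Matrix.cons_val_one]
      ring
    rw [h, coeff_monomial, coeff_monomial]
    simp only [expVec_inj]
    split_ifs <;> first | rfl | omega
  | add p q hp hq => rw [map_add, coeff_add, hp, hq]; split_ifs <;> simp

theorem coeff_mul_X_one_pow (P : MvPolynomial (Fin 2) K) (k j m : ℕ) :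
    (P * X 1 ^ m).coeff (expVec k (j + m)) = P.coeff (expVec k j) := by
  rw [X_pow_eq_monomial, show expVec k (j + m) = expVec k j + Finsupp.single 1 m by
    simp [expVec, add_assoc], coeff_mul_monomial, mul_one]

theorem coeff_tangentCone (P : MvPolynomial (Fin 2) K) (k j : ℕ) :
    (tangentCone P).coeff (expVec k j) =
      if k + j = minMonomialDeg P then P.coeff (expVec k j) else 0 := by
  rw [tangentCone, coeff_homogeneousComponent, degree_expVec]

theorem minMonomialDeg_le {P : MvPolynomial (Fin 2) K} {k j : ℕ} (h : P.coeff (expVec k j) ≠ 0) :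
    minMonomialDeg P ≤ k + j :=
  Nat.sInf_le ⟨expVec k j, mem_support_iff.2 h, sum_expVec k j⟩

theorem X_zero_dvd_iff (P : MvPolynomial (Fin 2) K) :
    X 0 ∣ P ↔ ∀ j, P.coeff (expVec 0 j) = 0 := by
  classical
  constructor
  · rintro ⟨Q, rfl⟩ j
    rw [coeff_X_mul']
    simp
  · intro h
    rw [P.as_sum]
    refine Finset.dvd_sum fun s hs => X_dvd_monomial.2 (Or.inr fun h0 => ?_)
    have := h (s 1)
    rw [← h0, expVec_apply] at this
    exact mem_support_iff.1 hs this

theorem blowup_iterate_support {F : ℕ → MvPolynomial (Fin 2) K} {nseq : ℕ → ℕ}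
    (hnseq : ∀ r : ℕ, 1 ≤ r →
      IsLeast {m : ℕ | ∃ s ∈ (F (r - 1)).support, (s.sum fun _ e => e) = m} (nseq r))
    (hFr : ∀ r : ℕ, 1 ≤ r →
      F r * (X 1 : MvPolynomial (Fin 2) K) ^ (nseq r) = aeval ![X 0 * X 1, X 1] (F (r - 1)))
    (r : ℕ) : ∃ N : ℕ,
      (∀ k j, (F r).coeff (expVec k j) ≠ 0 →
        ∃ j₀, (F 0).coeff (expVec k j₀) ≠ 0 ∧ j + N = j₀ + r * k) ∧
      ∀ k j₀, (F 0).coeff (expVec k j₀) ≠ 0 →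
        ∃ j, (F r).coeff (expVec k j) ≠ 0 ∧ j + N = j₀ + r * k := by
  induction r with
  | zero => exact ⟨0, fun k j h => ⟨j, h, by simp⟩, fun k j h => ⟨j, h, by simp⟩⟩
  | succ r ih =>
    obtain ⟨N, h1, h2⟩ := ih
    have hstep : ∀ k j, (F (r + 1)).coeff (expVec k j) =
        if k ≤ j + nseq (r + 1) then (F r).coeff (expVec k (j + nseq (r + 1) - k)) else 0 := by
      intro k j
      rw [← coeff_mul_X_one_pow _ k j (nseq (r + 1)), hFr (r + 1) (by omega), coeff_aeval_blowup,
        Nat.add_sub_cancel]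
    refine ⟨N + nseq (r + 1), fun k j h => ?_, fun k j₀ h => ?_⟩
    · rw [hstep] at h
      split_ifs at h with hk
      · obtain ⟨j₀, hj₀, he⟩ := h1 _ _ h
        exact ⟨j₀, hj₀, by rw [add_mul]; omega⟩
      · exact absurd rfl h
    · obtain ⟨j, hj, he⟩ := h2 _ _ h
      have hle : nseq (r + 1) ≤ k + j :=
        (hnseq (r + 1) (by omega)).2 ⟨expVec k j, mem_support_iff.2 hj, sum_expVec k j⟩
      refine ⟨k + j - nseq (r + 1), ?_, by rw [add_mul]; omega⟩
      rw [hstep, if_pos (by omega)]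
      convert hj using 3
      omega

theorem coeff_planarCurve (A : ℕ → K) (d k j : ℕ) :
    ((X 1 : MvPolynomial (Fin 2) K) ^ (d - 2) +
      ∑ i ∈ Finset.Icc 3 d, C (A i) * (X 1) ^ (d - i) *
        ∑ k ∈ Finset.range i, C ((((i - 1).choose k + 1 : ℕ) : K)) * (X 0) ^ k).coeff
          (expVec k j) =
      (if k = 0 ∧ j = d - 2 then 1 else 0) +
      ∑ i ∈ Finset.Icc 3 d, if k < i ∧ j = d - i then A i * (((i - 1).choose k + 1 : ℕ) : K)
        else 0 := by
  classical
  rw [coeff_add, coeff_sum]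
  congr 1
  · have h : (X 1 : MvPolynomial (Fin 2) K) ^ (d - 2) = monomial (expVec 0 (d - 2)) 1 := by
      rw [monomial_expVec]; simp
    rw [h, coeff_monomial]
    simp only [expVec_inj]
    split_ifs <;> first | rfl | omega
  · refine Finset.sum_congr rfl fun i _ => ?_
    have h : ∀ x, C (A i) * (X 1 : MvPolynomial (Fin 2) K) ^ (d - i) *
        (C ((((i - 1).choose x + 1 : ℕ) : K)) * (X 0) ^ x) =
        monomial (expVec x (d - i)) (A i * (((i - 1).choose x + 1 : ℕ) : K)) := by
      intro x; rw [monomial_expVec, C_mul]; ring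
    rw [Finset.mul_sum, coeff_sum]
    simp only [h, coeff_monomial, expVec_inj]
    by_cases hj : j = d - i
    · simp [hj]
    · simp [hj, Ne.symm hj]

theorem coeff_planarCurve_ne_zero {A : ℕ → K} {d k j : ℕ} (h2 : (2 : K) = 0)
    (h : (if k = 0 ∧ j = d - 2 then 1 else 0) +
      ∑ i ∈ Finset.Icc 3 d, (if k < i ∧ j = d - i then A i * (((i - 1).choose k + 1 : ℕ) : K)
        else 0) ≠ 0) :
    (k = 0 ∧ j = d - 2) ∨
      ∃ i, 3 ≤ i ∧ i ≤ d ∧ A i ≠ 0 ∧ j + i = d ∧ 2 ^ padicValNat 2 i ≤ k := by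
  by_contra! hcon
  refine h ?_
  rw [if_neg (fun hh => hcon.1 hh.1 hh.2), zero_add]
  refine Finset.sum_eq_zero fun i hi => ?_
  rw [Finset.mem_Icc] at hi
  split_ifs with hk
  · by_cases hA : A i = 0
    · rw [hA, zero_mul]
    · have hlt := hcon.2 i hi.1 hi.2 hA (by omega)
      obtain ⟨b, hb⟩ := odd_choose_of_lt_two_pow (by omega) pow_padicValNat_dvd hlt
      rw [hb]
      push_cast
      linear_combination (A i * (b + 1)) * h2
  · rfl

theorem coeff_planarCurve_lowest {A : ℕ → K} {d i : ℕ} (h2 : (2 : K) = 0)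
    (hi3 : 3 ≤ i) (hid : i ≤ d) (hA : A i ≠ 0) (hpow : ∀ k, i ≠ 2 ^ k) :
    (if 2 ^ padicValNat 2 i = 0 ∧ d - i = d - 2 then 1 else 0) +
      ∑ l ∈ Finset.Icc 3 d, (if 2 ^ padicValNat 2 i < l ∧ d - i = d - l then
        A l * (((l - 1).choose (2 ^ padicValNat 2 i) + 1 : ℕ) : K) else 0) ≠ 0 := by
  rw [if_neg (fun hh => by have := hh.1; simp at this), zero_add,
    Finset.sum_eq_single_of_mem i (Finset.mem_Icc.2 ⟨hi3, hid⟩)]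
  · have hlt : 2 ^ padicValNat 2 i < i :=
      lt_of_le_of_ne (Nat.le_of_dvd (by omega) pow_padicValNat_dvd) (hpow _).symm
    rw [if_pos ⟨hlt, rfl⟩]
    obtain ⟨b, hb⟩ := even_choose_two_pow_padicValNat (i := i) (by omega)
    rw [hb]
    push_cast
    have : ((b : K) + b + 1) = 1 := by linear_combination (b : K) * h2
    rwa [this, mul_one]
  · intro l hl hne
    rw [Finset.mem_Icc] at hl
    exact if_neg (by omega)

end

theorem unique_monomial_of_min_odd_degree
    {K : Type*} [Field K] [Fintype K] (n : ℕ) (hn : 1 ≤ n)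
    (hcard : Fintype.card K = 2 ^ n)
    (f : Polynomial K) (d : ℕ) (hd : f.natDegree = d) (hd3 : 3 ≤ d)
    (hAd : f.coeff d ≠ 0)
    (hdeg : d ^ 4 ≤ Fintype.card K)
    (h2pow : ∀ i k : ℕ, i = 2 ^ k → f.coeff i = 0)
    (hplanar : ∀ ε : K, ε ≠ 0 →
      Function.Bijective fun x : K => f.eval (x + ε) + f.eval x + ε * x)
    (F : ℕ → MvPolynomial (Fin 2) K) (nseq : ℕ → ℕ)
    (hF0 : F 0 = (X 1 : MvPolynomial (Fin 2) K) ^ (d - 2) +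
      ∑ i ∈ Finset.Icc 3 d, C (f.coeff i) * (X 1) ^ (d - i) *
        ∑ k ∈ Finset.range i, C ((((i - 1).choose k + 1 : ℕ) : K)) * (X 0) ^ k)
    (hnseq : ∀ r : ℕ, 1 ≤ r →
      IsLeast {m : ℕ | ∃ s ∈ (F (r - 1)).support, (s.sum fun _ e => e) = m} (nseq r))
    (hFr : ∀ r : ℕ, 1 ≤ r →
      F r * (X 1 : MvPolynomial (Fin 2) K) ^ (nseq r) = aeval ![X 0 * X 1, X 1] (F (r - 1)))
    (t : ℕ) (ht1 : 1 ≤ t)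
    (ht : ¬ (X 0 : MvPolynomial (Fin 2) K) ∣ tangentCone (F t))
    (htleast : ∀ s : ℕ, s < t → (X 0 : MvPolynomial (Fin 2) K) ∣ tangentCone (F s))
    (u : ℕ)
    (hu : IsLeast {u' : ℕ | ∃ ℓ : ℕ,
      (tangentCone (F (t - 1))).coeff
        (Finsupp.single (0 : Fin 2) (2 ^ u') + Finsupp.single (1 : Fin 2) ℓ) ≠ 0} u)
    (o : ℕ → ℤ)
    (hoodd : ∀ i : ℕ, Odd i →
      o i = 2 ^ (u - 1) * ((t : ℤ) + 1) - 1 - 2 ^ (u - 1) * (i : ℤ) + 2 ^ u + 2)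
    (hoeven : ∀ i : ℕ, Even i →
      o i = (2 ^ (padicValNat 2 i) + 1) * (2 ^ (u - 1) * ((t : ℤ) + 1) - 1)
        - 2 ^ (u - 1) * (i : ℤ) + 2 ^ u + 2)
    (m : ℤ)
    (hm : IsLeast {x : ℤ | ∃ i : ℕ, 3 ≤ i ∧ i ≤ d ∧ f.coeff i ≠ 0 ∧ o i = x} m)
    :
    ∃! i : ℕ, 3 ≤ i ∧ i ≤ d ∧ f.coeff i ≠ 0 ∧ o i = m := by
  have h2 : (2 : K) = 0 := by
    have h := Nat.cast_card_eq_zero K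
    rw [hcard] at h
    push_cast at h
    exact eq_zero_of_pow_eq_zero h
  set S : Set ℕ := {i | 3 ≤ i ∧ i ≤ d ∧ f.coeff i ≠ 0} with hS
  have hne_pow : ∀ i ∈ S, ∀ k, i ≠ 2 ^ k := fun i hi k hk => hi.2.2 (h2pow i k hk)
  have hlow : ∀ i ∈ S, (F 0).coeff (expVec (2 ^ padicValNat 2 i) (d - i)) ≠ 0 := by
    intro i hi
    rw [hF0, coeff_planarCurve]
    exact coeff_planarCurve_lowest h2 hi.1 hi.2.1 hi.2.2 (hne_pow i hi)
  have hsupp : ∀ k j, (F 0).coeff (expVec k j) ≠ 0 → (k = 0 ∧ j = d - 2) ∨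
      ∃ i ∈ S, j + i = d ∧ 2 ^ padicValNat 2 i ≤ k := by
    intro k j h
    rw [hF0, coeff_planarCurve] at h
    obtain h | ⟨i, h3, hid, hA, h⟩ := coeff_planarCurve_ne_zero h2 h
    exacts [Or.inl h, Or.inr ⟨i, ⟨h3, hid, hA⟩, h⟩]
  have hpure : (F 0).coeff (expVec 0 (d - 2)) ≠ 0 := by
    rw [hF0, coeff_planarCurve, if_pos ⟨rfl, rfl⟩, Finset.sum_eq_zero, add_zero]
    · exact one_ne_zero
    · intro i hi
      rw [Finset.mem_Icc] at hi
      exact if_neg (by omega)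
  have hle : ∀ i ∈ S, i ≤ (t + 1) * 2 ^ padicValNat 2 i + 2 := by
    intro i hi
    obtain ⟨N, h1, h2'⟩ := blowup_iterate_support hnseq hFr t
    rw [X_zero_dvd_iff] at ht
    push Not at ht
    obtain ⟨j, hj⟩ := ht
    rw [coeff_tangentCone] at hj
    split_ifs at hj with hdegj
    · obtain ⟨j₀, hj₀, he⟩ := h1 _ _ hj
      have hj₀d : j₀ = d - 2 := by
        obtain h | ⟨l, -, -, h⟩ := hsupp _ _ hj₀
        · exact h.2
        · simp at h
      obtain ⟨j', hj', he'⟩ := h2' _ _ (hlow i hi)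
      have := minMonomialDeg_le hj'
      have := hi.2.1
      rw [add_mul]
      omega
    · exact absurd rfl hj
  obtain ⟨N, h1, h2'⟩ := blowup_iterate_support hnseq hFr (t - 1)
  obtain ⟨⟨l, hl⟩, -⟩ := hu
  change (tangentCone (F (t - 1))).coeff (expVec (2 ^ u) l) ≠ 0 at hl
  rw [coeff_tangentCone] at hl
  split_ifs at hl with hdegl
  swap
  · exact absurd rfl hl
  obtain ⟨j₀, hj₀, he⟩ := h1 _ _ hl
  obtain h | ⟨i₀, hi₀, hji, hvu⟩ := hsupp _ _ hj₀
  · simp at h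
  obtain ⟨s, rfl⟩ : ∃ s, t = s + 1 := ⟨t - 1, by omega⟩
  rw [Nat.add_sub_cancel] at *
  have hmin : ∀ i ∈ S, (s + 1) * 2 ^ u + i ≤ (s + 1) * 2 ^ padicValNat 2 i + i₀ := by
    intro i hi
    obtain ⟨j', hj', he'⟩ := h2' _ _ (hlow i hi)
    have := minMonomialDeg_le hj'
    have := hi.2.1
    rw [add_mul, add_mul]
    omega
  have hv : padicValNat 2 i₀ = u := by
    have h := hmin i₀ hi₀
    have h' : 2 ^ u ≤ 2 ^ padicValNat 2 i₀ :=
      Nat.le_of_mul_le_mul_left (Nat.le_of_add_le_add_right h) s.succ_pos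
    exact Nat.pow_right_injective le_rfl (le_antisymm hvu h')
  have hlt : (s + 1) * 2 ^ u + 2 < i₀ := by
    obtain ⟨j, hj, hej⟩ := h2' _ _ hpure
    have hle' := minMonomialDeg_le hj
    have hcone := (X_zero_dvd_iff _).1 (htleast s (by omega)) j
    rw [coeff_tangentCone] at hcone
    have hne : 0 + j ≠ minMonomialDeg (F s) := fun h => hj (by rwa [if_pos h] at hcone)
    rw [add_mul]
    omega
  obtain ⟨⟨i, hi3, hid, hA, hoi⟩, hmle⟩ := hm
  refine ⟨i, ⟨hi3, hid, hA, hoi⟩, ?_⟩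
  rintro i' ⟨hi3', hid', hA', hoi'⟩
  exact (eq_of_min_order (fun i hi => hi.1) hle hmin hi₀ hv hlt hoodd hoeven
    (i := i) (i' := i') ⟨hi3, hid, hA⟩ ⟨hi3', hid', hA'⟩
    (fun k hk => hoi ▸ hmle ⟨k, hk.1, hk.2.1, hk.2.2, rfl⟩) (hoi.trans hoi'.symm)).symm
end
end
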